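/- Equivalence theorem. Let M be a complex vector space (not assumed graded) with a linear map Y_M(·,x) satisfying the truncation condition. (i) If modified weak associativity holds for all u, v ∈ V and all s ∈ ℤ with some exponents k'(u,v) ∈ ℕ, and weak commutativity holds for all u, v ∈ V with exponents k(u,v) ∈ ℕ, then modified weak associativity also holds with the exponents k(u,v) in place of k'(u,v) (in particular k'(u,v) may be lowered to k(u,v)), and the twisted Jacobi identity holds. If, in addition, M = ⊕_{n∈ℚ} M_(n) is ℚ-graded with dim M_(n) < ∞ and M_(n) = 0 for n sufficiently negative, the operator L_M(0) := Res_x x Y_M(ω,x) acts as n on M_(n), and Y_M(1,x) = id_M, then M is a ν-twisted V-module. (ii) Conversely, if the twisted Jacobi identity holds, then modified weak associativity and weak commutativity hold. -/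

import Mathlib

noncomputable section

open scoped BigOperators

/-- Generalized binomial coefficient `z(z-1)⋯(z-k+1)/k!`. -/
def cbinom (z : ℂ) (k : ℕ) : ℂ :=
  (∏ j ∈ Finset.range k, (z - (j : ℂ))) / (k.factorial : ℂ)

/-- Generalized binomial coefficient with integer lower index (zero for negative index). -/
def cbinomZ (z : ℂ) (k : ℤ) : ℂ := if 0 ≤ k then cbinom z k.toNat else 0

/-- A vertex operator algebra `(V, Y, 𝟙, ω)` over `ℂ`, described in terms of the modes
`vₙ = Y v n` of the vertex operators `Y(v,x) = ∑ₙ vₙ x^{-n-1}`.  The Jacobi identity is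
expressed in its equivalent component (Borcherds identity) form: it is the equality of the
coefficients of `x₀^{-n-1} x₁^{-a-1} x₂^{-b-1}` on the two sides of the formal-variable
Jacobi identity, with all binomials expanded by the binomial expansion convention. -/
structure VOA (V : Type) [AddCommGroup V] [Module ℂ V] where
  Y : V →ₗ[ℂ] ℤ → Module.End ℂ V
  vac : V
  conf : V
  cc : ℂ
  grade : ℤ → Submodule ℂ V
  internal : DirectSum.IsInternal grade
  findim : ∀ n : ℤ, FiniteDimensional ℂ (grade n)
  bddBelow : ∃ N : ℤ, ∀ n < N, grade n = ⊥
  trunc : ∀ u v : V, ∃ N : ℤ, ∀ n ≥ N, Y u n v = 0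
  vacuum : ∀ n : ℤ, Y vac n = if n = -1 then 1 else 0
  creation_zero : ∀ (v : V) (n : ℤ), 0 ≤ n → Y v n vac = 0
  creation_id : ∀ v : V, Y v (-1) vac = v
  virasoro : ∀ m n : ℤ,
    Y conf (m + 1) * Y conf (n + 1) - Y conf (n + 1) * Y conf (m + 1)
      = ((m - n : ℤ) : ℂ) • Y conf (m + n + 1)
        + (if m + n = 0 then ((m ^ 3 - m : ℤ) : ℂ) / 12 * cc else 0) •
            (1 : Module.End ℂ V)
  L0_grade : ∀ n : ℤ, ∀ v ∈ grade n, Y conf 1 v = (n : ℂ) • v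
  L_neg_one : ∀ (u : V) (n : ℤ), Y (Y conf 0 u) n = (-n : ℂ) • Y u (n - 1)
  jacobi : ∀ (u v w : V) (a n b : ℤ),
    (∑ᶠ i : ℕ, cbinom (a : ℂ) i • Y (Y u (n + i) v) (a + b - i) w)
      = (∑ᶠ i : ℕ, ((-1 : ℂ) ^ i * cbinom (n : ℂ) i) • Y u (a + n - i) (Y v (b + i) w))
        - (-1 : ℂ) ^ n •
            (∑ᶠ i : ℕ, ((-1 : ℂ) ^ i * cbinom (n : ℂ) i) • Y v (b + n - i) (Y u (a + i) w))

variable {V W : Type} [AddCommGroup V] [Module ℂ V] [AddCommGroup W] [Module ℂ W]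

/-- Truncation condition for a module-type vertex operator map. -/
def TruncW (YW : V →ₗ[ℂ] ℤ → Module.End ℂ W) : Prop :=
  ∀ (v : V) (w : W), ∃ N : ℤ, ∀ n ≥ N, YW v n w = 0

/-- The Jacobi identity for a module map `Y_W`, in component form. -/
def JacobiW (𝒜 : VOA V) (YW : V →ₗ[ℂ] ℤ → Module.End ℂ W) : Prop :=
  ∀ (u v : V) (w : W) (a n b : ℤ),
    (∑ᶠ i : ℕ, cbinom (a : ℂ) i • YW (𝒜.Y u (n + i) v) (a + b - i) w)
      = (∑ᶠ i : ℕ, ((-1 : ℂ) ^ i * cbinom (n : ℂ) i) • YW u (a + n - i) (YW v (b + i) w))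
        - (-1 : ℂ) ^ n •
            (∑ᶠ i : ℕ, ((-1 : ℂ) ^ i * cbinom (n : ℂ) i) • YW v (b + n - i) (YW u (a + i) w))

section Twisted

variable {V M : Type} [AddCommGroup V] [Module ℂ V] [AddCommGroup M] [Module ℂ M]

/-- Truncation condition for a twisted-module-type vertex operator map.  Here, for a fixed
period `p`, the map `Y_M` is encoded by its modes in `(1/p)ℤ`, rescaled by `p`:
`YM v N` is the mode `v^ν_{N/p}`, the coefficient of `x^{-N/p-1}` in `Y_M(v,x)`. -/
def TwTrunc (YM : V →ₗ[ℂ] ℤ → Module.End ℂ M) : Prop :=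
  ∀ (v : V) (w : M), ∃ N : ℤ, ∀ n ≥ N, YM v n w = 0

/-- The twisted Jacobi identity in component form: the equality of the coefficients of
`x₀^{-n-1} x₁^{-a/p-1} x₂^{-b/p-1}` on the two sides of the twisted Jacobi identity,
with all binomials expanded by the binomial expansion convention. -/
def TwJacobi (p : ℕ) (𝒜 : VOA V) (ν : V ≃ₗ[ℂ] V) (ωp : ℂ)
    (YM : V →ₗ[ℂ] ℤ → Module.End ℂ M) : Prop :=
  ∀ (u v : V) (w : M) (n a b : ℤ),
    (∑ᶠ i : ℕ, ((-1 : ℂ) ^ i * cbinom (n : ℂ) i) •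
        YM u (a + (p : ℤ) * (n - i)) (YM v (b + (p : ℤ) * i) w))
      - (-1 : ℂ) ^ n •
          (∑ᶠ i : ℕ, ((-1 : ℂ) ^ i * cbinom (n : ℂ) i) •
            YM v (b + (p : ℤ) * (n - i)) (YM u (a + (p : ℤ) * i) w))
      = (p : ℂ)⁻¹ • ∑ r ∈ Finset.range p, ωp ^ (-(r : ℤ) * a) •
          (∑ᶠ i : ℕ, cbinom ((a : ℂ) / (p : ℂ)) i •
            YM (𝒜.Y ((ν ^ r) u) (n + i) v) (a + b - (p : ℤ) * i) w)

/-- Weak commutativity for twisted vertex operators with exponent `k`: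
`(x₁-x₂)^k Y_M(u,x₁)Y_M(v,x₂) = (x₁-x₂)^k Y_M(v,x₂)Y_M(u,x₁)`, as the equality of the
coefficients of `x₁^{a/p} x₂^{b/p}` (endomorphism-valued). -/
def TwWC (p : ℕ) (YM : V →ₗ[ℂ] ℤ → Module.End ℂ M) (k : ℕ) (u v : V) : Prop :=
  ∀ a b : ℤ,
    (∑ᶠ i : ℕ, ((-1 : ℂ) ^ i * cbinom (k : ℂ) i) •
        (YM u ((p : ℤ) * ((k : ℤ) - i) - a - p) * YM v ((p : ℤ) * i - b - p)))
      = ∑ᶠ i : ℕ, ((-1 : ℂ) ^ i * cbinom (k : ℂ) i) •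
          (YM v ((p : ℤ) * i - b - p) * YM u ((p : ℤ) * ((k : ℤ) - i) - a - p))

/-- Modified weak associativity for twisted vertex operators with exponent `k`:
`lim_{x₁^{1/p} → ωₚ^s (x₂+x₀)^{1/p}} ((x₁-x₂)^k Y_M(u,x₁)Y_M(v,x₂))
   = x₀^k Y_M(Y(ν^{-s}u,x₀)v,x₂)` for all `s ∈ ℤ`, stated as the equality of the
coefficients of `x₀^n x₂^{C/p}` applied to an arbitrary vector `w`.  In the formal limit,
each integral power of `x₁^{1/p}` is replaced by the corresponding binomially expanded
power of `ωₚ^s (x₂+x₀)^{1/p}`. -/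
def TwMWA (p : ℕ) (𝒜 : VOA V) (ν : V ≃ₗ[ℂ] V) (ωp : ℂ)
    (YM : V →ₗ[ℂ] ℤ → Module.End ℂ M) (k : ℕ) (u v : V) : Prop :=
  ∀ (s n C : ℤ) (w : M),
    (∑ᶠ a : ℤ, (ωp ^ (s * a) * cbinomZ ((a : ℂ) / (p : ℂ)) n) •
        (∑ᶠ i : ℕ, ((-1 : ℂ) ^ i * cbinom (k : ℂ) i) •
          YM u ((p : ℤ) * ((k : ℤ) - i) - a - p)
            (YM v ((p : ℤ) * i - (C - a + (p : ℤ) * n) - p) w)))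
      = YM (𝒜.Y ((ν ^ (-s)) u) ((k : ℤ) - n - 1) v) (-C - p) w

end Twisted

section TwistedModule

variable {V M : Type} [AddCommGroup V] [Module ℂ V] [AddCommGroup M] [Module ℂ M]

/-- `M`, with the mode map `YM` and the `ℚ`-grading `grade`, is a `ν`-twisted module for
the vertex operator algebra `𝒜`: the grading axioms, the truncation condition, the vacuum
property `Y_M(𝟙,x) = id` (whose only nonzero mode is the one of `x⁰`, i.e. the rescaled
mode index `-p`), the Virasoro relations for `L_M(n) = ω^ν_{n+1}` with central charge
`c_V`, the `L_M(0)`-grading property, the `L(-1)`-derivative property, and the twisted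
Jacobi identity. -/
def IsTwistedModule (p : ℕ) (𝒜 : VOA V) (ν : V ≃ₗ[ℂ] V) (ωp : ℂ)
    (YM : V →ₗ[ℂ] ℤ → Module.End ℂ M) (grade : ℚ → Submodule ℂ M) : Prop :=
  DirectSum.IsInternal grade ∧
  (∀ q : ℚ, FiniteDimensional ℂ (grade q)) ∧
  (∃ N : ℚ, ∀ q < N, grade q = ⊥) ∧
  (∀ (v : V) (w : M), ∃ N : ℤ, ∀ n ≥ N, YM v n w = 0) ∧
  (∀ n : ℤ, YM 𝒜.vac n = if n = -(p : ℤ) then 1 else 0) ∧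
  (∀ m n : ℤ,
    YM 𝒜.conf ((p : ℤ) * (m + 1)) * YM 𝒜.conf ((p : ℤ) * (n + 1))
        - YM 𝒜.conf ((p : ℤ) * (n + 1)) * YM 𝒜.conf ((p : ℤ) * (m + 1))
      = ((m - n : ℤ) : ℂ) • YM 𝒜.conf ((p : ℤ) * (m + n + 1))
        + (if m + n = 0 then ((m ^ 3 - m : ℤ) : ℂ) / 12 * 𝒜.cc else 0) •
            (1 : Module.End ℂ M)) ∧
  (∀ q : ℚ, ∀ w ∈ grade q, YM 𝒜.conf (p : ℤ) w = (q : ℂ) • w) ∧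
  (∀ (u : V) (N : ℤ), YM (𝒜.Y 𝒜.conf 0 u) N = (-(N : ℂ) / (p : ℂ)) • YM u (N - p)) ∧
  TwJacobi p 𝒜 ν ωp YM

end TwistedModule

section Binomials

lemma cbinom_eq_choose (z : ℂ) (k : ℕ) : cbinom z k = Ring.choose z k := by
  rw [cbinom, Ring.choose_eq_smul, ← Polynomial.aeval_eq_smeval, Polynomial.aeval_def,
    Polynomial.eval₂_eq_eval_map, descPochhammer_map, descPochhammer_eval_eq_prod_range,
    div_eq_inv_mul, smul_eq_mul]

lemma cbinom_natCast (n k : ℕ) : cbinom (n : ℂ) k = (n.choose k : ℂ) := by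
  rw [cbinom_eq_choose, Ring.choose_natCast]

@[simp] lemma cbinom_zero_right (z : ℂ) : cbinom z 0 = 1 := by simp [cbinom]

@[simp] lemma cbinom_one_right (z : ℂ) : cbinom z 1 = z := by simp [cbinom]

lemma cbinom_three (z : ℂ) : cbinom z 3 = z * (z - 1) * (z - 2) / 6 := by
  simp [cbinom, Finset.prod_range_succ, Nat.factorial]

lemma cbinom_neg (z : ℂ) (k : ℕ) :
    cbinom (-z) k = (-1) ^ k * cbinom (z + k - 1) k := by
  rw [cbinom_eq_choose, cbinom_eq_choose, Ring.choose_neg, ← Int.cast_negOnePow_natCast,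
    Units.smul_def, zsmul_eq_mul]

lemma cbinom_zero_left {k : ℕ} (hk : k ≠ 0) : cbinom 0 k = 0 := by
  obtain ⟨k, rfl⟩ := Nat.exists_eq_succ_of_ne_zero hk
  simp [cbinom, Finset.prod_range_succ']

/-- The power series `(1 - X) ^ n`. -/
def oneSubPow (n : ℤ) : PowerSeries ℂ :=
  PowerSeries.mk fun i => (-1) ^ i * cbinom (n : ℂ) i

lemma coeff_oneSubPow (n : ℤ) (i : ℕ) :
    PowerSeries.coeff i (oneSubPow n) = (-1) ^ i * cbinom (n : ℂ) i := by
  simp [oneSubPow]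

lemma oneSubPow_eq_rescale (n : ℤ) :
    oneSubPow n = PowerSeries.rescale (-1 : ℂ) (PowerSeries.binomialSeries ℂ (n : ℂ)) := by
  ext i
  simp [oneSubPow, cbinom_eq_choose]

lemma oneSubPow_add (m n : ℤ) : oneSubPow (m + n) = oneSubPow m * oneSubPow n := by
  simp only [oneSubPow_eq_rescale, Int.cast_add, PowerSeries.binomialSeries_add, map_mul]

lemma oneSubPow_zero : oneSubPow 0 = 1 := by
  simp only [oneSubPow_eq_rescale, Int.cast_zero, PowerSeries.binomialSeries_zero, map_one]

lemma cbinom_add (x y : ℂ) (m : ℕ) :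
    cbinom (x + y) m = ∑ i ∈ Finset.range (m + 1), cbinom x i * cbinom y (m - i) := by
  rw [cbinom_eq_choose, Ring.add_choose_eq m (Commute.all x y),
    Finset.Nat.sum_antidiagonal_eq_sum_range_succ_mk]
  simp [cbinom_eq_choose]

lemma cbinomZ_of_neg (z : ℂ) {k : ℤ} (hk : k < 0) : cbinomZ z k = 0 := by
  simp [cbinomZ, hk.not_ge]

@[simp] lemma cbinomZ_natCast (z : ℂ) (k : ℕ) : cbinomZ z (k : ℤ) = cbinom z k := by
  simp [cbinomZ]

@[simp] lemma cbinomZ_zero_right (z : ℂ) : cbinomZ z 0 = 1 := by simp [cbinomZ]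

@[simp] lemma cbinomZ_one_right (z : ℂ) : cbinomZ z 1 = z := by simp [cbinomZ]

lemma finsum_cbinom_mul_cbinomZ (x y : ℂ) (m : ℤ) :
    ∑ᶠ i : ℕ, cbinom x i * cbinomZ y (m - i) = cbinomZ (x + y) m := by
  rcases lt_or_ge m 0 with hm | hm
  · rw [cbinomZ_of_neg _ hm]
    refine (finsum_congr fun i => ?_).trans finsum_zero
    rw [cbinomZ_of_neg _ (by omega), mul_zero]
  · lift m to ℕ using hm
    rw [cbinomZ_natCast, cbinom_add, finsum_eq_sum_of_support_subset (s := Finset.range (m + 1))]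
    · refine Finset.sum_congr rfl fun i hi => ?_
      rw [← cbinomZ_natCast y, Nat.cast_sub (by simpa [Nat.lt_succ_iff] using hi)]
    · intro i hi
      by_contra hi'
      refine hi ?_
      simp only [Finset.coe_range, Set.mem_Iio, not_lt] at hi'
      simp only
      rw [cbinomZ_of_neg _ (by omega), mul_zero]

lemma finite_support_cbinom_mul_cbinomZ (x y : ℂ) (m : ℤ) :
    (Function.support fun i : ℕ => cbinom x i * cbinomZ y (m - i)).Finite := by
  refine (Set.finite_Iio (m + 1).toNat).subset fun i hi => ?_
  by_contra hi'
  refine hi ?_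
  simp only [Set.mem_Iio, not_lt] at hi'
  simp only
  rw [cbinomZ_of_neg _ (by omega), mul_zero]

/-- `(1 - y)^q` expanded at zero minus its expansion at infinity is a derivative of the
formal delta function. -/
lemma cbinomZ_sub_cbinomZ (q e : ℤ) :
    (-1 : ℂ) ^ (q - e) * cbinomZ (q : ℂ) (q - e) - (-1) ^ (q + e) * cbinomZ (q : ℂ) e
      = cbinomZ (-e - 1) (-q - 1) := by
  have hsign : (-1 : ℂ) ^ (q - e) = (-1) ^ (q + e) := by
    rw [show q + e = (q - e) + 2 * e by ring, zpow_add₀ (by norm_num), zpow_mul]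
    simp
  have hneg : ∀ {e : ℤ} {n : ℕ}, -e - 1 = (n : ℤ) → (-(e : ℂ) - 1) = n := by
    intro e n h
    have := congrArg (Int.cast : ℤ → ℂ) h
    push_cast at this
    exact this
  rcases le_or_gt 0 q with hq | hq
  · rw [cbinomZ_of_neg _ (show -q - 1 < 0 by omega), hsign, ← mul_sub]
    refine mul_eq_zero_of_right _ (sub_eq_zero.2 ?_)
    lift q to ℕ using hq
    rcases lt_or_ge e 0 with he | he
    · rw [cbinomZ_of_neg _ he]
      lift (q : ℤ) - e to ℕ using by omega with r hr
      rw [cbinomZ_natCast, Int.cast_natCast, cbinom_natCast, Nat.choose_eq_zero_of_lt (by omega)]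
      simp
    · lift e to ℕ using he
      rcases lt_or_ge q e with h | h
      · rw [cbinomZ_of_neg _ (by omega), cbinomZ_natCast, Int.cast_natCast, cbinom_natCast,
          Nat.choose_eq_zero_of_lt h]
        simp
      · rw [← Nat.cast_sub h, cbinomZ_natCast, cbinomZ_natCast, Int.cast_natCast, cbinom_natCast,
          cbinom_natCast, Nat.choose_symm h]
  · obtain ⟨Q, hQ⟩ := Int.eq_ofNat_of_zero_le (show 0 ≤ -q - 1 by omega)
    have hq' : (q : ℂ) = -((Q : ℂ) + 1) := by
      have := hneg hQ; linear_combination -this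
    rw [hQ, cbinomZ_natCast]
    rcases lt_or_ge e 0 with he | he
    · obtain ⟨E, hE⟩ := Int.eq_ofNat_of_zero_le (show 0 ≤ -e - 1 by omega)
      rw [cbinomZ_of_neg _ he, mul_zero, sub_zero, hneg hE, cbinom_natCast]
      rcases lt_or_ge (q - e) 0 with h | h
      · rw [cbinomZ_of_neg _ h, Nat.choose_eq_zero_of_lt (by omega)]
        simp
      · obtain ⟨r, hr⟩ := Int.eq_ofNat_of_zero_le h
        have hEr : E = Q + r := by omega
        rw [hr, cbinomZ_natCast, hq', cbinom_neg, zpow_natCast, ← mul_assoc, ← pow_add,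
          ← two_mul, pow_mul]
        have : (Q : ℂ) + 1 + r - 1 = (E : ℕ) := by rw [hEr]; push_cast; ring
        rw [this, cbinom_natCast, hEr, Nat.choose_symm_add]
        simp
    · lift e to ℕ using he
      rw [cbinomZ_of_neg _ (show q - (e : ℤ) < 0 by omega), mul_zero, zero_sub, cbinomZ_natCast,
        hq', cbinom_neg]
      have h1 : (Q : ℂ) + 1 + e - 1 = ((Q + e : ℕ) : ℂ) := by push_cast; ring
      have h2 : -(((e : ℕ) : ℤ) : ℂ) - 1 = -((e : ℂ) + 1) := by push_cast; ring
      have h3 : (e : ℂ) + 1 + Q - 1 = ((Q + e : ℕ) : ℂ) := by push_cast; ring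
      rw [h1, h2, cbinom_neg, h3, cbinom_natCast, cbinom_natCast, Nat.choose_symm_add,
        show q + (e : ℤ) = -((Q : ℤ) + 1) + (e : ℤ) by omega, zpow_add₀ (by norm_num), zpow_neg,
        zpow_natCast, zpow_add₀ (by norm_num), zpow_natCast, zpow_one]
      have he2 : (-1 : ℂ) ^ e * (-1) ^ e = 1 := by rw [← mul_pow]; simp
      have hQ2 : ((-1 : ℂ) ^ Q)⁻¹ = (-1) ^ Q := by rw [← inv_pow]; norm_num
      rw [mul_inv, hQ2]
      linear_combination (-1 : ℂ) ^ Q * ((Q + e).choose e : ℂ) * he2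

lemma cbinom_ne_zero {z : ℂ} {n : ℕ} (h : ∀ j < n, z ≠ j) : cbinom z n ≠ 0 := by
  rw [cbinom]
  refine div_ne_zero (Finset.prod_ne_zero_iff.2 fun j hj => sub_ne_zero.2 (h j ?_)) ?_
  · simpa using hj
  · exact_mod_cast n.factorial_ne_zero

end Binomials

section Sequences

variable {E : Type*} [AddCommGroup E]

/-- The sequence vanishes for sufficiently negative indices. -/
def ZeroNearBot (f : ℤ → E) : Prop := ∃ B : ℤ, ∀ N < B, f N = 0

/-- The sequence vanishes for sufficiently large indices. -/
def ZeroNearTop (f : ℤ → E) : Prop := ∃ B : ℤ, ∀ N ≥ B, f N = 0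

/-- Along every progression of step `d`, the sequence vanishes eventually. -/
def StepZero (d : ℤ) (f : ℤ → E) : Prop := ∀ a : ℤ, ∃ K : ℕ, ∀ i ≥ K, f (a + d * (i : ℤ)) = 0

lemma ZeroNearBot.stepZero {f : ℤ → E} (hf : ZeroNearBot f) {p : ℕ} (hp : 0 < p) :
    StepZero (-(p : ℤ)) f := by
  obtain ⟨B, hB⟩ := hf
  refine fun a => ⟨(a - B + 1).toNat, fun i hi => hB _ ?_⟩
  have h1 : (a - B + 1) ≤ (i : ℤ) := by omega
  have h2 : (i : ℤ) ≤ p * i := by nlinarith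
  linarith

lemma ZeroNearTop.stepZero {f : ℤ → E} (hf : ZeroNearTop f) {p : ℕ} (hp : 0 < p) :
    StepZero (p : ℤ) f := by
  obtain ⟨B, hB⟩ := hf
  refine fun a => ⟨(B - a).toNat, fun i hi => hB _ ?_⟩
  have h1 : (B - a) ≤ (i : ℤ) := by omega
  have h2 : (i : ℤ) ≤ p * i := by nlinarith
  linarith

lemma finsum_nat_eq_sum_range {φ : ℕ → E} {K : ℕ} (h : ∀ i ≥ K, φ i = 0) :
    ∑ᶠ i, φ i = ∑ i ∈ Finset.range K, φ i := by
  refine finsum_eq_sum_of_support_subset _ fun i hi => ?_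
  by_contra h'
  exact hi (h i (by simpa using h'))

variable [Module ℂ E]

/-- The action of a formal power series in the shift by `d` on sequences. -/
def shiftAct (d : ℤ) (c : PowerSeries ℂ) (f : ℤ → E) (a : ℤ) : E :=
  ∑ᶠ i : ℕ, PowerSeries.coeff i c • f (a + d * (i : ℤ))

lemma shiftAct_eq_sum {d : ℤ} (c : PowerSeries ℂ) {f : ℤ → E} {a : ℤ} {K : ℕ}
    (h : ∀ i ≥ K, f (a + d * (i : ℤ)) = 0) :
    shiftAct d c f a = ∑ i ∈ Finset.range K, PowerSeries.coeff i c • f (a + d * (i : ℤ)) :=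
  finsum_nat_eq_sum_range fun i hi => by rw [h i hi, smul_zero]

lemma shiftAct_one (d : ℤ) (f : ℤ → E) : shiftAct d 1 f = f := by
  ext a
  rw [shiftAct, finsum_eq_single _ 0 fun i hi => by simp [PowerSeries.coeff_one, hi]]
  simp

lemma shiftAct_eq_zero {d : ℤ} (c : PowerSeries ℂ) {f : ℤ → E} {a : ℤ}
    (h : ∀ i : ℕ, f (a + d * (i : ℤ)) = 0) : shiftAct d c f a = 0 := by
  simp [shiftAct, h]

lemma shiftAct_translate (d : ℤ) (c : PowerSeries ℂ) (f : ℤ → E) (t a : ℤ) :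
    shiftAct d c (fun x => f (x + t)) a = shiftAct d c f (a + t) := by
  refine finsum_congr fun i => ?_
  rw [add_right_comm]

lemma shiftAct_smul (d : ℤ) (c : PowerSeries ℂ) (z : ℂ) (f : ℤ → E) (a : ℤ) :
    shiftAct d c (fun x => z • f x) a = z • shiftAct d c f a := by
  rw [shiftAct, shiftAct, smul_finsum]
  exact finsum_congr fun i => smul_comm _ _ _

lemma shiftAct_mul {d : ℤ} (c c' : PowerSeries ℂ) {f : ℤ → E} (hf : StepZero d f) (a : ℤ) :
    shiftAct d (c * c') f a = shiftAct d c (shiftAct d c' f) a := by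
  obtain ⟨K, hK⟩ := hf a
  have hinner : ∀ i : ℕ, shiftAct d c' f (a + d * i) =
      ∑ j ∈ Finset.range K, PowerSeries.coeff j c' • f (a + d * ((i + j : ℕ) : ℤ)) := by
    intro i
    have h : ∀ j ≥ K, f (a + d * (i : ℤ) + d * (j : ℤ)) = 0 := fun j hj => by
      have := hK (i + j) (by omega)
      rwa [Nat.cast_add, mul_add, ← add_assoc] at this
    rw [shiftAct_eq_sum c' h]
    refine Finset.sum_congr rfl fun j _ => ?_
    rw [Nat.cast_add, mul_add, ← add_assoc]
  have houter : ∀ i ≥ K, shiftAct d c' f (a + d * (i : ℤ)) = 0 := fun i hi => by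
    rw [hinner]
    exact Finset.sum_eq_zero fun j _ => by rw [hK _ (by omega), smul_zero]
  rw [shiftAct_eq_sum _ hK, shiftAct_eq_sum _ houter]
  simp only [hinner, Finset.smul_sum, smul_smul, PowerSeries.coeff_mul, Finset.sum_smul]
  rw [Finset.sum_sigma', ← Finset.sum_product']
  have hsub : ∀ x ∈ (Finset.range K).sigma fun l => Finset.HasAntidiagonal.antidiagonal l,
      x.2 ∈ Finset.range K ×ˢ Finset.range K := by
    rintro ⟨l, i, j⟩ hx
    simp only [Finset.mem_sigma, Finset.mem_range, Finset.HasAntidiagonal.mem_antidiagonal,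
      Finset.mem_product] at hx ⊢
    omega
  rw [← Finset.sum_filter_of_ne (s := Finset.range K ×ˢ Finset.range K)
    (p := fun x => x.1 + x.2 < K)]
  · refine Finset.sum_bij (fun x _ => x.2) ?_ ?_ ?_ ?_
    · rintro ⟨l, i, j⟩ hx
      have := hsub _ hx
      simp only [Finset.mem_sigma, Finset.mem_range, Finset.HasAntidiagonal.mem_antidiagonal] at hx
      simp only [Finset.mem_filter, this, true_and]
      omega
    · rintro ⟨l, i, j⟩ hx ⟨l', i', j'⟩ hx' h
      simp only [Finset.mem_sigma, Finset.mem_range, Finset.HasAntidiagonal.mem_antidiagonal]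
        at hx hx'
      simp only [Prod.mk.injEq] at h
      obtain ⟨rfl, rfl⟩ := h
      obtain rfl : l = l' := by omega
      rfl
    · rintro ⟨i, j⟩ hx
      simp only [Finset.mem_filter, Finset.mem_product, Finset.mem_range] at hx
      exact ⟨⟨i + j, i, j⟩, by simp [hx.2], rfl⟩
    · rintro ⟨l, i, j⟩ hx
      simp only [Finset.mem_sigma, Finset.mem_range, Finset.HasAntidiagonal.mem_antidiagonal] at hx
      simp only [← hx.2]
  · rintro ⟨i, j⟩ _ h
    by_contra h'
    exact h (by rw [hK _ (by simpa using h'), smul_zero])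

lemma shiftAct_add {d : ℤ} (c : PowerSeries ℂ) {f g : ℤ → E} (hf : StepZero d f)
    (hg : StepZero d g) (a : ℤ) :
    shiftAct d c (f + g) a = shiftAct d c f a + shiftAct d c g a := by
  obtain ⟨K, hK⟩ := hf a
  obtain ⟨L, hL⟩ := hg a
  have h1 : ∀ i ≥ max K L, f (a + d * (i : ℤ)) = 0 := fun i hi => hK i (by omega)
  have h2 : ∀ i ≥ max K L, g (a + d * (i : ℤ)) = 0 := fun i hi => hL i (by omega)
  rw [shiftAct_eq_sum c h1, shiftAct_eq_sum c h2,
    shiftAct_eq_sum (K := max K L) c fun i hi => by simp [h1 i hi, h2 i hi],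
    ← Finset.sum_add_distrib]
  exact Finset.sum_congr rfl fun i _ => by rw [Pi.add_apply, smul_add]

/-- Multiplication by `(x₁ - x₂) ^ n`, expanded in nonnegative powers of `x₂`. -/
def binP (p : ℕ) (n : ℤ) (f : ℤ → E) (a : ℤ) : E :=
  shiftAct (-(p : ℤ)) (oneSubPow n) f (a + p * n)

/-- Multiplication by `(-x₂ + x₁) ^ n`, expanded in nonnegative powers of `x₁`. -/
def binQ (p : ℕ) (n : ℤ) (g : ℤ → E) (a : ℤ) : E :=
  (-1 : ℂ) ^ n • shiftAct (p : ℤ) (oneSubPow n) g a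

variable {p : ℕ} {f g : ℤ → E}

lemma binP_zero : binP p 0 f = f := by
  ext a
  rw [binP, oneSubPow_zero, shiftAct_one, mul_zero, add_zero]

lemma binQ_zero : binQ p 0 g = g := by
  ext a
  rw [binQ, oneSubPow_zero, shiftAct_one, zpow_zero, one_smul]

lemma ZeroNearBot.binP (hf : ZeroNearBot f) (n : ℤ) : ZeroNearBot (binP p n f) := by
  obtain ⟨B, hB⟩ := hf
  refine ⟨B - p * n, fun N hN => shiftAct_eq_zero _ fun i => hB _ ?_⟩
  have : (0 : ℤ) ≤ p * i := by positivity
  linarith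

lemma ZeroNearTop.binQ (hg : ZeroNearTop g) (n : ℤ) : ZeroNearTop (binQ p n g) := by
  obtain ⟨B, hB⟩ := hg
  refine ⟨B, fun N hN => ?_⟩
  rw [_root_.binQ, shiftAct_eq_zero, smul_zero]
  intro i
  refine hB _ ?_
  have : (0 : ℤ) ≤ p * i := by positivity
  linarith

lemma binP_binP (hp : 0 < p) (hf : ZeroNearBot f) (m n : ℤ) :
    binP p m (binP p n f) = binP p (m + n) f := by
  ext a
  unfold binP
  rw [shiftAct_translate, oneSubPow_add, shiftAct_mul _ _ (hf.stepZero hp),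
    mul_add, ← add_assoc]

lemma binQ_binQ (hp : 0 < p) (hg : ZeroNearTop g) (m n : ℤ) :
    binQ p m (binQ p n g) = binQ p (m + n) g := by
  ext a
  unfold binQ
  rw [shiftAct_smul, oneSubPow_add, shiftAct_mul _ _ (hg.stepZero hp), smul_smul,
    zpow_add₀ (by norm_num)]

lemma binP_natCast (k : ℕ) (a : ℤ) :
    binP p k f a = ∑ i ∈ Finset.range (k + 1),
      ((-1 : ℂ) ^ i * (k.choose i : ℂ)) • f (a + p * ((k : ℤ) - i)) := by
  rw [binP, shiftAct, finsum_nat_eq_sum_range (K := k + 1)]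
  · refine Finset.sum_congr rfl fun i _ => ?_
    rw [coeff_oneSubPow, Int.cast_natCast, cbinom_natCast]
    congr 2
    ring
  · intro i hi
    rw [coeff_oneSubPow, Int.cast_natCast, cbinom_natCast, Nat.choose_eq_zero_of_lt (by omega)]
    simp

lemma binQ_natCast (k : ℕ) (a : ℤ) : binQ p k f a = binP p k f a := by
  rw [binP_natCast, binQ, shiftAct, finsum_nat_eq_sum_range (K := k + 1),
    ← Finset.sum_range_reflect, Finset.smul_sum]
  · refine Finset.sum_congr rfl fun i hi => ?_
    simp only [Finset.mem_range] at hi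
    obtain ⟨j, rfl⟩ : ∃ j, k = i + j := ⟨k - i, by omega⟩
    have : i + j + 1 - 1 - i = j := by omega
    rw [this, coeff_oneSubPow, Int.cast_natCast, cbinom_natCast, smul_smul, zpow_natCast,
      Nat.choose_symm_add]
    congr 1
    · rw [pow_add]
      have : (-1 : ℂ) ^ j * (-1) ^ j = 1 := by rw [← mul_pow]; simp
      linear_combination (-1) ^ i * ((i + j).choose j : ℂ) * this
    · congr 1
      push_cast
      ring
  · intro i hi
    rw [coeff_oneSubPow, Int.cast_natCast, cbinom_natCast, Nat.choose_eq_zero_of_lt (by omega)]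
    simp

lemma binP_natCast_eq_fwdDiff (k : ℕ) : binP p k f = (fwdDiff (p : ℤ))^[k] f := by
  ext a
  rw [fwdDiff_iter_eq_sum_shift, ← binQ_natCast, binQ, shiftAct,
    finsum_nat_eq_sum_range (K := k + 1), Finset.smul_sum]
  · refine Finset.sum_congr rfl fun i hi => ?_
    simp only [Finset.mem_range] at hi
    obtain ⟨j, rfl⟩ : ∃ j, k = i + j := ⟨k - i, by omega⟩
    rw [coeff_oneSubPow, Int.cast_natCast, cbinom_natCast, smul_smul, zpow_natCast,
      ← Int.cast_smul_eq_zsmul ℂ, Nat.add_sub_cancel_left]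
    congr 1
    · push_cast
      rw [pow_add]
      have : (-1 : ℂ) ^ i * (-1) ^ i = 1 := by rw [← mul_pow]; simp
      linear_combination (-1) ^ j * ((i + j).choose i : ℂ) * this
    · congr 1
      simp only [nsmul_eq_mul]
      ring
  · intro i hi
    rw [coeff_oneSubPow, Int.cast_natCast, cbinom_natCast, Nat.choose_eq_zero_of_lt (by omega)]
    simp

lemma binP_natCast_sub (k : ℕ) : binP p k (f - g) = binP p k f - binP p k g := by
  ext a
  simp only [binP_natCast, Pi.sub_apply, smul_sub, Finset.sum_sub_distrib]

lemma binP_natCast_binP (j k : ℕ) : binP p j (binP p k f) = binP p (j + k : ℕ) f := by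
  rw [binP_natCast_eq_fwdDiff, binP_natCast_eq_fwdDiff, binP_natCast_eq_fwdDiff,
    Function.iterate_add_apply]

end Sequences

section TwistedLines

variable {E : Type*} [AddCommGroup E]

lemma finsupp_zeroNearBot (h : ℤ →₀ E) : ZeroNearBot h := by
  obtain ⟨B, hB⟩ := h.hasFiniteSupport.bddBelow
  exact ⟨B, fun N hN => by by_contra h'; exact (hB h').not_gt hN⟩

lemma finsupp_zeroNearTop (h : ℤ →₀ E) : ZeroNearTop h := by
  obtain ⟨B, hB⟩ := h.hasFiniteSupport.bddAbove
  exact ⟨B + 1, fun N hN => by by_contra h'; have := hB h'; omega⟩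

lemma exists_finsupp_eq {h : ℤ → E} (h1 : ZeroNearBot h) (h2 : ZeroNearTop h) :
    ∃ h' : ℤ →₀ E, ⇑h' = h := by
  obtain ⟨B, hB⟩ := h1
  obtain ⟨C, hC⟩ := h2
  have : (Function.support h).Finite := (Set.finite_Ico B C).subset fun N hN => by
    by_contra h'
    simp only [Set.mem_Ico, not_and_or, not_le, not_lt] at h'
    rcases h' with h' | h'
    · exact hN (hB N h')
    · exact hN (hC N h')
  exact ⟨Finsupp.ofSupportFinite h this, rfl⟩

variable [Module ℂ E]

/-- The coefficients of `lim_{x₁^{1/p} → ω^{-s}(x₂+x₀)^{1/p}} h`, divided by `x₀ ^ k`. -/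
def limCoeff (p : ℕ) (ω : ℂ) (k : ℤ) (h : ℤ → E) (s j : ℤ) : E :=
  ∑ᶠ a : ℤ, (ω ^ (-s * a) * cbinomZ ((a : ℂ) / p) (k - 1 - j)) • h (-a - p)

/-- The iterate side of the twisted Jacobi identity. -/
def iterSide (p : ℕ) (ω : ℂ) (γ : ℤ → ℤ → E) (n a : ℤ) : E :=
  (p : ℂ)⁻¹ • ∑ r ∈ Finset.range p, ω ^ (-(r : ℤ) * a) •
    ∑ᶠ i : ℕ, cbinom ((a : ℂ) / p) i • γ r (n + i)

/-- The twisted Jacobi identity for the coefficient sequences `f` and `g` of the two products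
and `γ` of the iterates. -/
def JacobiSeq (p : ℕ) (ω : ℂ) (f g : ℤ → E) (γ : ℤ → ℤ → E) : Prop :=
  ∀ n a : ℤ, binP p n f a - binQ p n g a = iterSide p ω γ n a

/-- Uniform vanishing of `γ s j` for large `j`. -/
def UnifZeroNearTop (γ : ℤ → ℤ → E) : Prop := ∃ B : ℤ, ∀ s : ℤ, ∀ j ≥ B, γ s j = 0

lemma finsum_eq_sum_of_unifZeroNearTop {γ : ℤ → ℤ → E} {B : ℤ}
    (h : ∀ s : ℤ, ∀ j ≥ B, γ s j = 0) (z : ℂ) (s n : ℤ) {K : ℕ} (hK : B - n ≤ K) :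
    ∑ᶠ i : ℕ, cbinom z i • γ s (n + i) =
      ∑ i ∈ Finset.range K, cbinom z i • γ s (n + i) :=
  finsum_nat_eq_sum_range fun i hi => by rw [h s _ (by omega), smul_zero]

variable {p : ℕ} {ω : ℂ}

lemma iterSide_sub {γ γ' : ℤ → ℤ → E} (h : UnifZeroNearTop γ) (h' : UnifZeroNearTop γ')
    (n a : ℤ) :
    iterSide p ω (γ - γ') n a = iterSide p ω γ n a - iterSide p ω γ' n a := by
  obtain ⟨B, hB⟩ := h
  obtain ⟨B', hB'⟩ := h'
  have h1 : ∀ s : ℤ, ∀ j ≥ max B B', γ s j = 0 := fun s j hj => hB s j (by omega)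
  have h2 : ∀ s : ℤ, ∀ j ≥ max B B', γ' s j = 0 := fun s j hj => hB' s j (by omega)
  have h3 : ∀ s : ℤ, ∀ j ≥ max B B', (γ - γ') s j = 0 := fun s j hj => by
    simp [h1 s j hj, h2 s j hj]
  have hK : max B B' - n ≤ ((max B B' - n).toNat : ℕ) := by omega
  simp only [iterSide, finsum_eq_sum_of_unifZeroNearTop h1 _ _ _ hK,
    finsum_eq_sum_of_unifZeroNearTop h2 _ _ _ hK, finsum_eq_sum_of_unifZeroNearTop h3 _ _ _ hK]
  simp only [Pi.sub_apply, smul_sub, Finset.sum_sub_distrib]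

lemma iterSide_add {γ γ' : ℤ → ℤ → E} (h : UnifZeroNearTop γ) (h' : UnifZeroNearTop γ')
    (n a : ℤ) :
    iterSide p ω (γ + γ') n a = iterSide p ω γ n a + iterSide p ω γ' n a := by
  have h'' : UnifZeroNearTop (γ + γ') := by
    obtain ⟨B, hB⟩ := h
    obtain ⟨B', hB'⟩ := h'
    exact ⟨max B B', fun s j hj => by simp [hB s j (by omega), hB' s j (by omega)]⟩
  have := iterSide_sub (p := p) (ω := ω) h'' h' n a
  rw [add_sub_cancel_right] at this
  rw [this, sub_add_cancel]

lemma iterSide_zero (n a : ℤ) : iterSide p ω (0 : ℤ → ℤ → E) n a = 0 := by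
  simp [iterSide]

lemma limCoeff_unifZeroNearTop (k : ℤ) (h : ℤ → E) : UnifZeroNearTop (limCoeff p ω k h) :=
  ⟨k, fun s j hj => by
    refine (finsum_congr fun a => ?_).trans finsum_zero
    rw [cbinomZ_of_neg _ (by omega), mul_zero, zero_smul]⟩

lemma limCoeff_single (k N : ℤ) (m : E) (s j : ℤ) :
    limCoeff p ω k (Finsupp.single N m) s j =
      (ω ^ (s * (N + p)) * cbinomZ (-(N : ℂ) / p - p / p) (k - 1 - j)) • m := by
  rw [limCoeff, finsum_eq_single _ (-N - p)]
  · have h1 : -(-N - (p : ℤ)) - p = N := by ring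
    rw [h1, Finsupp.single_eq_same]
    congr 2
    · congr 1; ring
    · congr 1; push_cast; ring
  · intro a ha
    rw [Finsupp.single_eq_of_ne, smul_zero]
    intro h; exact ha (by omega)

lemma limCoeff_add (k : ℤ) (h h' : ℤ →₀ E) :
    limCoeff p ω k (⇑(h + h')) = limCoeff p ω k h + limCoeff p ω k h' := by
  have key : ∀ (h : ℤ →₀ E) (c : ℤ → ℂ),
      (Function.support fun a : ℤ => c a • h (-a - p)).Finite := by
    intro h c
    refine ((h.hasFiniteSupport).preimage (f := fun a : ℤ => -a - (p : ℤ)) ?_).subset ?_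
    · intro a _ b _ hab
      simp only at hab
      omega
    · intro a ha ha'
      exact ha (by simp only at ha' ⊢; rw [ha', smul_zero])
  ext s j
  simp only [limCoeff, Pi.add_apply, Finsupp.add_apply, smul_add]
  exact finsum_add_distrib (key h _) (key h' _)

lemma shiftAct_single_of_eq {d : ℤ} (hd : d ≠ 0) (c : PowerSeries ℂ) {N a : ℤ} (m : E) {i : ℕ}
    (h : a + d * i = N) :
    shiftAct d c (Finsupp.single N m) a = PowerSeries.coeff i c • m := by
  rw [shiftAct, finsum_eq_single _ i, h, Finsupp.single_eq_same]
  intro j hj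
  rw [Finsupp.single_eq_of_ne, smul_zero]
  intro h'
  have : d * (i : ℤ) = d * j := by linarith
  exact hj (by exact_mod_cast (mul_left_cancel₀ hd this).symm)

lemma shiftAct_single_of_ne {d : ℤ} (c : PowerSeries ℂ) {N a : ℤ} (m : E)
    (h : ∀ i : ℕ, a + d * i ≠ N) : shiftAct d c (Finsupp.single N m) a = 0 :=
  shiftAct_eq_zero _ fun i => Finsupp.single_eq_of_ne (h i)

lemma sum_pow_mul_eq (hω : IsPrimitiveRoot ω p) (N : ℤ) :
    ∑ r ∈ Finset.range p, ω ^ ((r : ℤ) * N) = if (p : ℤ) ∣ N then (p : ℂ) else 0 := by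
  have h1 : ∀ r : ℕ, ω ^ ((r : ℤ) * N) = (ω ^ N) ^ r := fun r => by
    rw [mul_comm, zpow_mul, zpow_natCast]
  simp only [h1]
  split_ifs with h
  · rw [(hω.zpow_eq_one_iff_dvd N).2 h]; simp
  · have hne : ω ^ N ≠ 1 := fun h' => h ((hω.zpow_eq_one_iff_dvd N).1 h')
    have hp1 : (ω ^ N) ^ p = 1 := by
      rw [← zpow_natCast, ← zpow_mul, mul_comm, zpow_mul, zpow_natCast, hω.pow_eq_one, one_zpow]
    rw [geom_sum_eq hne, hp1, sub_self, zero_div]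

lemma jacobiSeq_single (hp : 0 < p) (hω : IsPrimitiveRoot ω p) (k q N a : ℤ) (m : E) :
    binP p q (Finsupp.single N m) a - binQ p q (Finsupp.single N m) a =
      iterSide p ω (limCoeff p ω k (Finsupp.single N m)) (k + q) a := by
  have hpC : (p : ℂ) ≠ 0 := by exact_mod_cast hp.ne'
  have hpZ : (p : ℤ) ≠ 0 := by exact_mod_cast hp.ne'
  have hω0 : ω ≠ 0 := hω.ne_zero hp.ne'
  have hR : iterSide p ω (limCoeff p ω k (Finsupp.single N m)) (k + q) a =
      ((p : ℂ)⁻¹ * ((∑ r ∈ Finset.range p, ω ^ ((r : ℤ) * (N - a))) *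
        cbinomZ ((a : ℂ) / p + (-(N : ℂ) / p - p / p)) (-q - 1))) • m := by
    rw [iterSide, mul_smul, Finset.sum_mul, Finset.sum_smul]
    congr 1
    refine Finset.sum_congr rfl fun r _ => ?_
    simp only [limCoeff_single]
    have hterm : ∀ i : ℕ, cbinom ((a : ℂ) / p) i •
        (ω ^ ((r : ℤ) * (N + p)) *
          cbinomZ (-(N : ℂ) / p - p / p) (k - 1 - (k + q + (i : ℤ)))) • m =
        ω ^ ((r : ℤ) * N) • ((cbinom ((a : ℂ) / p) i *
          cbinomZ (-(N : ℂ) / p - p / p) (-q - 1 - i)) • m) := by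
      intro i
      have h1 : ω ^ ((r : ℤ) * (N + p)) = ω ^ ((r : ℤ) * N) := by
        rw [mul_add, zpow_add₀ hω0, mul_comm (r : ℤ) p, zpow_mul ω p, zpow_natCast ω,
          hω.pow_eq_one, one_zpow, mul_one]
      rw [h1, show k - 1 - (k + q + (i : ℤ)) = -q - 1 - i by ring]
      simp only [smul_smul]
      congr 1
      ring
    rw [finsum_congr hterm, ← smul_finsum,
      ← finsum_smul' (finite_support_cbinom_mul_cbinomZ _ _ _), finsum_cbinom_mul_cbinomZ, smul_smul,
      smul_smul,
      ← zpow_add₀ hω0]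
    congr 3
    ring
  rw [hR, sum_pow_mul_eq hω]
  split_ifs with h
  · obtain ⟨e, he⟩ := h
    have hP : binP p q (Finsupp.single N m) a =
        ((-1 : ℂ) ^ (q - e) * cbinomZ (q : ℂ) (q - e)) • m := by
      rw [binP]
      rcases lt_or_ge (q - e) 0 with h | h
      · rw [cbinomZ_of_neg _ h, mul_zero, zero_smul]
        refine shiftAct_single_of_ne _ m fun i hi => ?_
        have : (p : ℤ) * (q - e - i) = 0 := by linear_combination hi + he
        rcases mul_eq_zero.1 this with h' | h'
        · exact hpZ h'
        · omega
      · obtain ⟨i, hi⟩ := Int.eq_ofNat_of_zero_le h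
        rw [shiftAct_single_of_eq (i := i) (neg_ne_zero.2 hpZ), coeff_oneSubPow, hi,
          cbinomZ_natCast,
          zpow_natCast]
        linear_combination (-he) + p * hi
    have hQ : binQ p q (Finsupp.single N m) a =
        ((-1 : ℂ) ^ (q + e) * cbinomZ (q : ℂ) e) • m := by
      rw [binQ]
      rcases lt_or_ge e 0 with h | h
      · rw [cbinomZ_of_neg _ h, mul_zero, zero_smul, shiftAct_single_of_ne, smul_zero]
        intro i hi
        have : (p : ℤ) * (e - i) = 0 := by linear_combination -hi - he
        rcases mul_eq_zero.1 this with h' | h'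
        · exact hpZ h'
        · omega
      · obtain ⟨i, rfl⟩ := Int.eq_ofNat_of_zero_le h
        rw [shiftAct_single_of_eq (i := i) hpZ, coeff_oneSubPow, cbinomZ_natCast, smul_smul,
          zpow_add₀ (by norm_num), zpow_natCast, mul_assoc]
        linear_combination -he
    have hz : (a : ℂ) / p + (-(N : ℂ) / p - p / p) = -e - 1 := by
      have := congrArg (Int.cast : ℤ → ℂ) he
      push_cast at this
      field_simp
      linear_combination -this
    rw [hP, hQ, ← sub_smul, cbinomZ_sub_cbinomZ, hz, inv_mul_cancel_left₀ hpC]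
  · rw [zero_mul, mul_zero, zero_smul, binP, binQ, shiftAct_single_of_ne, shiftAct_single_of_ne,
      smul_zero, sub_self]
    · intro i hi
      exact h ⟨i, by linear_combination -hi⟩
    · intro i hi
      exact h ⟨q - i, by linear_combination -hi⟩

lemma jacobiSeq_finsupp (hp : 0 < p) (hω : IsPrimitiveRoot ω p) (k q a : ℤ) (h : ℤ →₀ E) :
    binP p q h a - binQ p q h a = iterSide p ω (limCoeff p ω k h) (k + q) a := by
  induction h using Finsupp.induction_linear with
  | zero =>
    have := jacobiSeq_single hp hω k q 0 a (0 : E)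
    rwa [Finsupp.single_zero] at this
  | add h h' ih ih' =>
    rw [limCoeff_add, iterSide_add (limCoeff_unifZeroNearTop _ _) (limCoeff_unifZeroNearTop _ _),
      ← ih, ← ih', Finsupp.coe_add]
    unfold binP binQ
    rw [shiftAct_add _ ((finsupp_zeroNearBot h).stepZero hp) ((finsupp_zeroNearBot h').stepZero hp),
      shiftAct_add _ ((finsupp_zeroNearTop h).stepZero hp) ((finsupp_zeroNearTop h').stepZero hp),
      smul_add]
    abel
  | single N m => exact jacobiSeq_single hp hω k q N a m

/-- The twisted Jacobi identity follows once `(x₁ - x₂) ^ k` makes the two products agree,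
with the iterates obtained by the formal limit. -/
lemma jacobiSeq_of_binP_eq_binQ (hp : 0 < p) (hω : IsPrimitiveRoot ω p) {f g : ℤ → E}
    (hf : ZeroNearBot f) (hg : ZeroNearTop g) {k : ℕ} (h : binP p k f = binQ p k g) :
    JacobiSeq p ω f g (limCoeff p ω k (binP p k f)) := by
  obtain ⟨h', hh'⟩ := exists_finsupp_eq (hf.binP (p := p) (k : ℤ))
    (h ▸ hg.binQ (k : ℤ) : ZeroNearTop (binP p k f))
  intro n a
  have := jacobiSeq_finsupp hp hω k (n - k) a h'
  rw [add_sub_cancel, hh'] at this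
  rw [← this]
  congr 1
  · rw [binP_binP hp hf, sub_add_cancel]
  · rw [h, binQ_binQ hp hg, sub_add_cancel]

lemma eq_of_sum_pow_smul_eq (hp : 0 < p) (hω : IsPrimitiveRoot ω p) {x y : ℕ → E}
    (h : ∀ a : ℤ, ∑ r ∈ Finset.range p, ω ^ (-(r : ℤ) * a) • x r =
      ∑ r ∈ Finset.range p, ω ^ (-(r : ℤ) * a) • y r) {r : ℕ} (hr : r < p) : x r = y r := by
  have hpC : (p : ℂ) ≠ 0 := by exact_mod_cast hp.ne'
  have hω0 : ω ≠ 0 := hω.ne_zero hp.ne'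
  have key : ∀ z : ℕ → E, ∑ a ∈ Finset.range p, ω ^ ((a : ℤ) * r) •
      ∑ t ∈ Finset.range p, ω ^ (-(t : ℤ) * a) • z t = (p : ℂ) • z r := by
    intro z
    simp only [Finset.smul_sum, smul_smul]
    rw [Finset.sum_comm]
    simp only [← Finset.sum_smul]
    rw [Finset.sum_eq_single_of_mem r (by simpa using hr)]
    · congr 1
      have : ∀ a : ℕ, ω ^ ((a : ℤ) * r) * ω ^ (-(r : ℤ) * a) = 1 := fun a => by
        rw [← zpow_add₀ hω0, show (a : ℤ) * r + -(r : ℤ) * a = 0 by ring, zpow_zero]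
      simp only [this, Finset.sum_const, Finset.card_range, nsmul_eq_mul, mul_one]
    · intro t ht htr
      have : ∀ a : ℕ, ω ^ ((a : ℤ) * r) * ω ^ (-(t : ℤ) * a) = ω ^ ((a : ℤ) * (r - t)) :=
        fun a => by rw [← zpow_add₀ hω0]; congr 1; ring
      simp only [this]
      rw [sum_pow_mul_eq hω, if_neg, zero_smul]
      rintro ⟨c, hc⟩
      simp only [Finset.mem_range] at ht
      have hc0 : c = 0 := by
        by_contra h0
        rcases lt_or_gt_of_ne h0 with h1 | h1
        · nlinarith
        · nlinarith
      subst hc0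
      omega
  have h2 := (key x).symm.trans
    ((Finset.sum_congr rfl fun a _ => by rw [h]).trans (key y))
  simpa [smul_smul, inv_mul_cancel₀ hpC] using congrArg (fun w => (p : ℂ)⁻¹ • w) h2

/-- The iterate side of the twisted Jacobi identity determines the iterates. -/
lemma eq_of_iterSide_eq (hp : 0 < p) (hω : IsPrimitiveRoot ω p) {γ γ' : ℤ → ℤ → E}
    (hγ : UnifZeroNearTop γ) (hγ' : UnifZeroNearTop γ')
    (hper : ∀ s j, γ (s + p) j = γ s j) (hper' : ∀ s j, γ' (s + p) j = γ' s j)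
    (h : ∀ n a, iterSide p ω γ n a = iterSide p ω γ' n a) : γ = γ' := by
  have hpC : (p : ℂ) ≠ 0 := by exact_mod_cast hp.ne'
  set δ := γ - γ' with hδ
  have hz : ∀ n a, iterSide p ω δ n a = 0 := fun n a => by
    rw [iterSide_sub hγ hγ', h, sub_self]
  obtain ⟨B, hB⟩ : UnifZeroNearTop δ := by
    obtain ⟨B, hB⟩ := hγ
    obtain ⟨B', hB'⟩ := hγ'
    exact ⟨max B B', fun s j hj => by simp [hδ, hB s j (by omega), hB' s j (by omega)]⟩
  have hperδ : ∀ (s j : ℤ), δ (s % p) j = δ s j := by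
    intro s j
    have hP : Function.Periodic (fun s => δ s j) (p : ℤ) := fun s => by simp [hδ, hper, hper']
    have := hP.sub_zsmul_eq (x := s) (s / p)
    rw [← this]
    congr 1
    simp only [smul_eq_mul]
    have := Int.emod_add_mul_ediv s p
    linarith
  have key : ∀ m : ℕ, ∀ s : ℤ, ∀ j ≥ B - m, δ s j = 0 := by
    intro m
    induction m with
    | zero => simpa using hB
    | succ m ih =>
      intro s j hj
      rcases lt_or_ge j (B - m) with hlt | hge
      swap; · exact ih s j hge
      have hrange : ∀ r : ℕ, r < p → δ r j = 0 := by
        intro r hr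
        refine eq_of_sum_pow_smul_eq (x := fun r => δ r j) (y := fun _ => 0) hp hω (fun a => ?_) hr
        have h0 := hz j a
        rw [iterSide, smul_eq_zero, or_iff_right (inv_ne_zero hpC)] at h0
        simp only [smul_zero, Finset.sum_const_zero]
        rw [← h0]
        refine Finset.sum_congr rfl fun r _ => ?_
        rw [finsum_eq_single _ 0]
        · simp
        · intro i hi
          rw [ih, smul_zero]
          omega
      rw [← hperδ, ← Int.toNat_of_nonneg (Int.emod_nonneg s (by omega))]
      exact hrange _ (by
        have := Int.emod_lt_of_pos s (show (0 : ℤ) < p by omega)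
        omega)
  ext s j
  refine sub_eq_zero.1 ?_
  exact key (B - j).toNat s j (by omega)

lemma limCoeff_periodic (hω : IsPrimitiveRoot ω p) (hp : 0 < p) (k : ℤ) (h : ℤ → E) (s j : ℤ) :
    limCoeff p ω k h (s + p) j = limCoeff p ω k h s j := by
  refine finsum_congr fun a => ?_
  have : ω ^ (-(s + p) * a) = ω ^ (-s * a) := by
    rw [neg_add, add_mul, zpow_add₀ (hω.ne_zero hp.ne'), zpow_mul ω (-(p : ℤ)), zpow_neg,
      zpow_natCast, hω.pow_eq_one]
    simp
  rw [this]

/-- The iterates in the twisted Jacobi identity are given by the formal limit. -/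
lemma JacobiSeq.eq_limCoeff (hp : 0 < p) (hω : IsPrimitiveRoot ω p) {f g : ℤ → E}
    {γ : ℤ → ℤ → E} (hJ : JacobiSeq p ω f g γ)
    (hf : ZeroNearBot f) (hg : ZeroNearTop g) (hγ : UnifZeroNearTop γ)
    (hper : ∀ s j, γ (s + p) j = γ s j) {k : ℕ} (h : binP p k f = binQ p k g) :
    γ = limCoeff p ω k (binP p k f) :=
  eq_of_iterSide_eq hp hω hγ (limCoeff_unifZeroNearTop _ _) hper (limCoeff_periodic hω hp _ _)
    fun n a => by rw [← hJ, jacobiSeq_of_binP_eq_binQ hp hω hf hg h]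

lemma JacobiSeq.sub (hp : 0 < p) {f f' g g' : ℤ → E} {γ γ' : ℤ → ℤ → E}
    (hJ : JacobiSeq p ω f g γ) (hJ' : JacobiSeq p ω f' g' γ')
    (hf : ZeroNearBot f) (hg : ZeroNearTop g) (hγ : UnifZeroNearTop γ)
    (hf' : ZeroNearBot f') (hg' : ZeroNearTop g') (hγ' : UnifZeroNearTop γ') :
    JacobiSeq p ω (f - f') (g - g') (γ - γ') := by
  intro n a
  have hneg : ∀ (d : ℤ) (φ ψ : ℤ → E) (c : PowerSeries ℂ) (b : ℤ), StepZero d φ → StepZero d ψ →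
      shiftAct d c (φ - ψ) b = shiftAct d c φ b - shiftAct d c ψ b := by
    intro d φ ψ c b hφ hψ
    have hs : StepZero d (φ - ψ) := fun a => by
      obtain ⟨K, hK⟩ := hφ a
      obtain ⟨L, hL⟩ := hψ a
      exact ⟨max K L, fun i hi => by simp [hK i (by omega), hL i (by omega)]⟩
    have := shiftAct_add c hs hψ b
    rw [sub_add_cancel] at this
    rw [this, add_sub_cancel_right]
  rw [iterSide_sub hγ hγ', ← hJ, ← hJ']
  unfold binP binQ
  rw [hneg _ _ _ _ _ (hf.stepZero hp) (hf'.stepZero hp),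
    hneg _ _ _ _ _ (hg.stepZero hp) (hg'.stepZero hp), smul_sub]
  abel

/-- If the iterates vanish, so does the product. -/
lemma JacobiSeq.eq_zero_of_iter_eq_zero (hp : 0 < p) {f g : ℤ → E} (hJ : JacobiSeq p ω f g 0)
    (hf : ZeroNearBot f) (hg : ZeroNearTop g) : f = 0 := by
  obtain ⟨B, hB⟩ := hg
  obtain ⟨C, hC⟩ := hf
  by_contra hne
  obtain ⟨N, hN⟩ := Function.ne_iff.1 hne
  -- a minimal index in the residue class of `N`
  obtain ⟨t, ht, hmin⟩ : ∃ t : ℕ, f (N - p * t) ≠ 0 ∧ ∀ i : ℕ, t < i → f (N - p * i) = 0 := by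
    classical
    have hex : ∃ K : ℕ, ∀ i ≥ K, f (N - p * (i : ℤ)) = 0 :=
      ⟨(N - C + 1).toNat, fun i hi => hC _ (by
        have h1 : (N - C + 1) ≤ (i : ℤ) := by omega
        have h2 : (i : ℤ) ≤ p * i := by nlinarith
        linarith)⟩
    have hpos : Nat.find hex ≠ 0 := by
      intro h0
      have := Nat.find_spec hex 0 (by omega)
      exact hN (by simpa using this)
    obtain ⟨t, ht⟩ := Nat.exists_eq_succ_of_ne_zero hpos
    refine ⟨t, fun h0 => Nat.find_min hex (m := t) (by omega) fun i hi => ?_, fun i hi =>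
      Nat.find_spec hex i (by omega)⟩
    rcases hi.lt_or_eq with h | rfl
    · exact Nat.find_spec hex i (by omega)
    · exact h0
  set N0 := N - p * (t : ℤ) with hN0
  set m : ℕ := (B - N0).toNat
  have hm : B - N0 ≤ (m : ℤ) := by omega
  have hm' : (m : ℤ) ≤ p * m := by nlinarith
  have h1 : binP p (-(m : ℤ)) f (N0 + p * m) = f N0 := by
    rw [binP, shiftAct, finsum_eq_single _ 0]
    · rw [coeff_oneSubPow]
      simp only [pow_zero, cbinom_zero_right, mul_one, one_smul]
      congr 1
      push_cast
      ring
    · intro i hi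
      have := hmin (t + i) (by omega)
      rw [show N0 + p * (m : ℤ) + p * -(m : ℤ) + -(p : ℤ) * i = N - p * ((t + i : ℕ) : ℤ) by
        rw [hN0]; push_cast; ring, this, smul_zero]
  have h2 : binQ p (-(m : ℤ)) g (N0 + p * m) = 0 := by
    rw [binQ, shiftAct_eq_zero, smul_zero]
    intro i
    refine hB _ ?_
    have : (0 : ℤ) ≤ p * i := by positivity
    linarith
  have := hJ (-(m : ℤ)) (N0 + p * m)
  rw [h1, h2, iterSide_zero, sub_zero] at this
  exact ht this

end TwistedLines

section Differences

variable {E : Type*} [AddCommGroup E] [Module ℂ E] {p : ℕ}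

lemma eq_zero_of_binP_eq_zero_of_top (hp : 0 < p) {d : ℤ → E} (hd : ZeroNearTop d) {k : ℕ}
    (h : binP p k d = 0) : d = 0 := by
  have h' : binQ p k d = 0 := by ext a; rw [binQ_natCast, h]
  have := binQ_binQ hp hd (-(k : ℤ)) k
  rw [h', neg_add_cancel, binQ_zero] at this
  rw [← this]
  ext a
  rw [binQ, shiftAct_eq_zero _ fun i => rfl, smul_zero, Pi.zero_apply]

lemma eq_zero_of_binP_eq_zero_of_bot (hp : 0 < p) {d : ℤ → E} (hd : ZeroNearBot d) {k : ℕ}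
    (h : binP p k d = 0) : d = 0 := by
  have := binP_binP hp hd (-(k : ℤ)) k
  rw [h, neg_add_cancel, binP_zero] at this
  rw [← this]
  ext a
  rw [binP, shiftAct_eq_zero _ fun i => rfl, Pi.zero_apply]

/-- A sequence killed by a power of the difference operator is determined by a window. -/
lemma eq_zero_of_window (hp : 0 < p) {d : ℤ → E} {k : ℕ} (h : binP p k d = 0)
    (hw : ∀ N : ℤ, 0 ≤ N → N < p * k → d N = 0) : d = 0 := by
  have key : ∀ a : ℤ, ∑ i ∈ Finset.range (k + 1),
      ((-1 : ℂ) ^ i * (k.choose i : ℂ)) • d (a + p * ((k : ℤ) - i)) = 0 := fun a => by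
    rw [← binP_natCast, h, Pi.zero_apply]
  have h1 : (fun N : ℤ => if 0 ≤ N then d N else 0) = 0 := by
    refine eq_zero_of_binP_eq_zero_of_bot (k := k) hp ⟨0, fun N hN => if_neg hN.not_ge⟩ ?_
    ext a
    rw [binP_natCast, Pi.zero_apply]
    rcases le_or_gt 0 a with ha | ha
    · rw [← key a]
      refine Finset.sum_congr rfl fun i hi => ?_
      rw [if_pos]
      simp only [Finset.mem_range] at hi
      have : (0 : ℤ) ≤ p * ((k : ℤ) - i) := mul_nonneg (by positivity) (by omega)
      linarith
    · refine Finset.sum_eq_zero fun i _ => ?_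
      split_ifs with h0
      · rw [hw _ h0, smul_zero]
        have : (0 : ℤ) ≤ p * i := by positivity
        linarith
      · rw [smul_zero]
  have h2 : (fun N : ℤ => if N < p * k then d N else 0) = 0 := by
    refine eq_zero_of_binP_eq_zero_of_top (k := k) hp ⟨p * k, fun N hN => if_neg hN.not_gt⟩ ?_
    ext a
    rw [binP_natCast, Pi.zero_apply]
    rcases lt_or_ge a 0 with ha | ha
    · rw [← key a]
      refine Finset.sum_congr rfl fun i hi => ?_
      rw [if_pos]
      have : (0 : ℤ) ≤ p * i := by positivity
      linarith
    · refine Finset.sum_eq_zero fun i hi => ?_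
      simp only [Finset.mem_range] at hi
      split_ifs with h0
      · rw [hw _ _ h0, smul_zero]
        have : (0 : ℤ) ≤ p * ((k : ℤ) - i) := mul_nonneg (by positivity) (by omega)
        linarith
      · rw [smul_zero]
  ext N
  rcases le_or_gt 0 N with hN | hN
  · have := congrFun h1 N
    simpa [hN] using this
  · have := congrFun h2 N
    have hlt : N < p * k := lt_of_lt_of_le hN (by positivity)
    simpa [hlt] using this

lemma mem_of_window (hp : 0 < p) {d : ℤ → E} {k : ℕ} (h : binP p k d = 0) (X : Submodule ℂ E)
    (hw : ∀ N : ℤ, 0 ≤ N → N < p * k → d N ∈ X) (N : ℤ) : d N ∈ X := by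
  rw [← Submodule.Quotient.mk_eq_zero]
  have : (fun N => (Submodule.Quotient.mk (d N) : E ⧸ X)) = 0 := by
    refine eq_zero_of_window (k := k) hp ?_ fun N h0 h1 =>
      (Submodule.Quotient.mk_eq_zero X).2 (hw N h0 h1)
    ext a
    have h2 := congrArg X.mkQ (congrFun h a)
    rw [binP_natCast, map_sum] at h2
    rw [binP_natCast]
    simpa using h2
  exact congrFun this N

lemma limCoeff_eq_zero_of_infinite (hp : 0 < p) {ω : ℂ} (hω : ω ≠ 0) (k : ℤ) {h : ℤ → E}
    (hinf : (Function.support h).Infinite) : limCoeff p ω k h = 0 := by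
  have hpC : (p : ℂ) ≠ 0 := by exact_mod_cast hp.ne'
  ext s j
  rw [limCoeff, Pi.zero_apply, Pi.zero_apply]
  rcases lt_or_ge (k - 1 - j) 0 with hn | hn
  · refine (finsum_congr fun a => ?_).trans finsum_zero
    rw [cbinomZ_of_neg _ hn, mul_zero, zero_smul]
  · refine finsum_of_infinite_support fun hfin => hinf ?_
    obtain ⟨n, hn'⟩ := Int.eq_ofNat_of_zero_le hn
    have hfin2 : ((fun a : ℤ => -a - (p : ℤ)) '' ((Function.support fun a : ℤ =>
        (ω ^ (-s * a) * cbinomZ ((a : ℂ) / p) (k - 1 - j)) • h (-a - p)) ∪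
        (fun i : ℕ => (p : ℤ) * i) '' Set.Iio n)).Finite :=
      (hfin.union ((Set.finite_Iio n).image _)).image _
    refine hfin2.subset fun N hN => ⟨-N - p, ?_, by ring⟩
    by_cases hc : ∃ i : ℕ, i < n ∧ (p : ℤ) * i = -N - p
    · obtain ⟨i, hi, h'⟩ := hc
      exact Or.inr ⟨i, hi, h'⟩
    · refine Or.inl ?_
      rw [Function.mem_support]
      refine smul_ne_zero (mul_ne_zero (zpow_ne_zero _ hω) ?_) ?_
      · rw [hn', cbinomZ_natCast]
        refine cbinom_ne_zero fun i hi h' => hc ⟨i, hi, ?_⟩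
        rw [div_eq_iff hpC] at h'
        have : (((p : ℤ) * i : ℤ) : ℂ) = ((-N - p : ℤ) : ℂ) := by
          rw [h']; push_cast; ring
        exact_mod_cast this
      · rw [show -(-N - (p : ℤ)) - p = N by ring]
        exact hN

lemma ZeroNearTop.binP_natCast {f : ℤ → E} (hf : ZeroNearTop f) (k : ℕ) :
    ZeroNearTop (binP p k f) := by
  obtain ⟨B, hB⟩ := hf.binQ (p := p) k
  exact ⟨B, fun N hN => by rw [← binQ_natCast, hB N hN]⟩

/-- Two products related by weak commutativity agree when the first one is truncated on both
sides. -/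
lemma eq_of_binP_eq_binP (hp : 0 < p) {f g : ℤ → E} (hf : ZeroNearTop f) (hg : ZeroNearTop g)
    {k : ℕ} (hc : binP p k f = binP p k g) : f = g := by
  obtain ⟨B, hB⟩ := hf
  obtain ⟨C, hC⟩ := hg
  refine sub_eq_zero.1 (eq_zero_of_binP_eq_zero_of_top (k := k) hp ⟨max B C, fun N hN => ?_⟩ ?_)
  · rw [Pi.sub_apply, hB N (by omega), hC N (by omega), sub_zero]
  · rw [binP_natCast_sub, hc, sub_self]

lemma jacobiSeq_of_binP_zeroNearTop (hp : 0 < p) {ω : ℂ} (hω : IsPrimitiveRoot ω p) {f g : ℤ → E}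
    {γ : ℤ → ℤ → E} (hf : ZeroNearBot f) (hg : ZeroNearTop g) {k k' : ℕ}
    (hc : binP p k f = binP p k g) (hγ : γ = limCoeff p ω k' (binP p k' f))
    (htop : ZeroNearTop (binP p k' f)) : JacobiSeq p ω f g γ := by
  rw [hγ]
  refine jacobiSeq_of_binP_eq_binQ hp hω hf hg ?_
  rw [eq_of_binP_eq_binP hp htop (hg.binP_natCast k') (k := k)]
  · ext a
    rw [binQ_natCast]
  · rw [binP_natCast_binP, Nat.add_comm, ← binP_natCast_binP, hc, binP_natCast_binP, Nat.add_comm,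
      ← binP_natCast_binP]

/-- Weak commutativity together with modified weak associativity gives the twisted Jacobi
identity, unless the formal limit is ill-defined, in which case the iterates vanish. -/
lemma jacobiSeq_or_eq_zero (hp : 0 < p) {ω : ℂ} (hω : IsPrimitiveRoot ω p) {f g : ℤ → E}
    {γ : ℤ → ℤ → E} (hf : ZeroNearBot f) (hg : ZeroNearTop g) {k k' : ℕ}
    (hc : binP p k f = binP p k g) (hγ : γ = limCoeff p ω k' (binP p k' f)) :
    JacobiSeq p ω f g γ ∨ γ = 0 := by
  by_cases hfin : (Function.support (binP p k' f)).Finite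
  · left
    refine jacobiSeq_of_binP_zeroNearTop hp hω hf hg hc hγ ?_
    obtain ⟨B, hB⟩ := hfin.bddAbove
    exact ⟨B + 1, fun N hN => by by_contra h'; have := hB h'; omega⟩
  · right
    rw [hγ]
    exact limCoeff_eq_zero_of_infinite hp (hω.ne_zero hp.ne') _ hfin

end Differences

section ModeSequences

variable {V M : Type} [AddCommGroup V] [Module ℂ V] [AddCommGroup M] [Module ℂ M]

/-- The coefficients of `Y_M(u,x₁)Y_M(v,x₂)w` of total mode index `S`. -/
def prodSeq (YM : V →ₗ[ℂ] ℤ → Module.End ℂ M) (u v : V) (w : M) (S N : ℤ) : M :=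
  YM u N (YM v (S - N) w)

/-- The coefficients of `Y_M(v,x₂)Y_M(u,x₁)w` of total mode index `S`. -/
def revSeq (YM : V →ₗ[ℂ] ℤ → Module.End ℂ M) (u v : V) (w : M) (S N : ℤ) : M :=
  YM v (S - N) (YM u N w)

/-- The coefficients of `Y_M(Y(ν^s u,x₀)v,x₂)w` of total mode index `S`. -/
def iterSeq (p : ℕ) (𝒜 : VOA V) (ν : V ≃ₗ[ℂ] V) (YM : V →ₗ[ℂ] ℤ → Module.End ℂ M) (u v : V)
    (w : M) (S s j : ℤ) : M :=
  YM (𝒜.Y ((ν ^ s) u) j v) (S - p * j) w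

variable {p : ℕ} {𝒜 : VOA V} {ν : V ≃ₗ[ℂ] V} {ω : ℂ} {YM : V →ₗ[ℂ] ℤ → Module.End ℂ M}

lemma prodSeq_zeroNearBot (hT : TwTrunc YM) (u v : V) (w : M) (S : ℤ) :
    ZeroNearBot (prodSeq YM u v w S) := by
  obtain ⟨B, hB⟩ := hT v w
  exact ⟨S - B, fun N hN => by rw [prodSeq, hB _ (by omega), map_zero]⟩

lemma revSeq_zeroNearTop (hT : TwTrunc YM) (u v : V) (w : M) (S : ℤ) :
    ZeroNearTop (revSeq YM u v w S) := by
  obtain ⟨B, hB⟩ := hT u w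
  exact ⟨B, fun N hN => by rw [revSeq, hB _ hN, map_zero]⟩

lemma zpow_add_period (hν : ν ^ p = 1) (s : ℤ) : ν ^ (s + p) = ν ^ s := by
  rw [zpow_add, zpow_natCast, hν, mul_one]

lemma exists_unif_trunc (𝒜 : VOA V) (hp : 0 < p) (hν : ν ^ p = 1) (u v : V) :
    ∃ B : ℤ, ∀ s : ℤ, ∀ j ≥ B, 𝒜.Y ((ν ^ s) u) j v = 0 := by
  choose B hB using fun r : ℕ => 𝒜.trunc ((ν ^ (r : ℤ)) u) v
  obtain ⟨C, hC⟩ := ((Finset.range p).image B).bddAbove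
  refine ⟨C, fun s j hj => ?_⟩
  have hs : ν ^ s = ν ^ (((s % p).toNat : ℕ) : ℤ) := by
    rw [Int.toNat_of_nonneg (Int.emod_nonneg s (by omega))]
    conv_lhs => rw [← Int.emod_add_mul_ediv s p, zpow_add, zpow_mul, zpow_natCast, hν, one_zpow,
      mul_one]
  rw [hs]
  have hlt := Int.emod_lt_of_pos s (show (0 : ℤ) < p by omega)
  refine hB _ _ (le_trans (hC ?_) hj)
  rw [Finset.coe_image]
  exact ⟨_, by simpa using (by omega : (s % (p : ℤ)).toNat < p), rfl⟩

lemma iterSeq_unifZeroNearTop (hp : 0 < p) (hν : ν ^ p = 1) (u v : V) (w : M) (S : ℤ) :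
    UnifZeroNearTop (iterSeq p 𝒜 ν YM u v w S) := by
  obtain ⟨B, hB⟩ := exists_unif_trunc 𝒜 hp hν u v
  exact ⟨B, fun s j hj => by rw [iterSeq, hB s j hj, map_zero]; rfl⟩

lemma iterSeq_periodic (hν : ν ^ p = 1) (u v : V) (w : M) (S s j : ℤ) :
    iterSeq p 𝒜 ν YM u v w S (s + p) j = iterSeq p 𝒜 ν YM u v w S s j := by
  rw [iterSeq, zpow_add_period hν, iterSeq]

lemma twJacobi_iff : TwJacobi p 𝒜 ν ω YM ↔ ∀ u v w S,
    JacobiSeq p ω (prodSeq YM u v w S) (revSeq YM u v w S) (iterSeq p 𝒜 ν YM u v w S) := by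
  have key : ∀ (u v : V) (w : M) (n a b S : ℤ), S = a + b + p * n →
      (((∑ᶠ i : ℕ, ((-1 : ℂ) ^ i * cbinom (n : ℂ) i) •
        YM u (a + (p : ℤ) * (n - i)) (YM v (b + (p : ℤ) * i) w))
      - (-1 : ℂ) ^ n •
          (∑ᶠ i : ℕ, ((-1 : ℂ) ^ i * cbinom (n : ℂ) i) •
            YM v (b + (p : ℤ) * (n - i)) (YM u (a + (p : ℤ) * i) w))
      = (p : ℂ)⁻¹ • ∑ r ∈ Finset.range p, ω ^ (-(r : ℤ) * a) •
          (∑ᶠ i : ℕ, cbinom ((a : ℂ) / (p : ℂ)) i •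
            YM (𝒜.Y ((ν ^ r) u) (n + i) v) (a + b - (p : ℤ) * i) w)) ↔
      binP p n (prodSeq YM u v w S) a - binQ p n (revSeq YM u v w S) a =
        iterSide p ω (iterSeq p 𝒜 ν YM u v w S) n a) := by
    intro u v w n a b S hS
    unfold binP binQ iterSide shiftAct prodSeq revSeq iterSeq
    simp only [coeff_oneSubPow, zpow_natCast]
    have e1 : ∀ i : ℕ, a + (p : ℤ) * n + -(p : ℤ) * i = a + (p : ℤ) * (n - i) := fun i => by ring
    have e2 : ∀ i : ℕ, S - (a + (p : ℤ) * (n - i)) = b + p * i := fun i => by rw [hS]; ring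
    have e3 : ∀ i : ℕ, S - (a + (p : ℤ) * i) = b + p * (n - i) := fun i => by rw [hS]; ring
    have e4 : ∀ i : ℕ, S - (p : ℤ) * (n + i) = a + b - p * i := fun i => by rw [hS]; ring
    simp only [e1, e2, e3, e4]
  constructor
  · intro h u v w S n a
    exact (key u v w n a (S - a - p * n) S (by ring)).1 (h u v w n a _)
  · intro h u v w n a b
    exact (key u v w n a b _ rfl).2 (h u v w _ n a)

lemma finsum_cbinom_natCast {F : Type*} [AddCommGroup F] [Module ℂ F] (k : ℕ) (φ : ℕ → F) :
    ∑ᶠ i : ℕ, ((-1 : ℂ) ^ i * cbinom (k : ℂ) i) • φ i =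
      ∑ i ∈ Finset.range (k + 1), ((-1 : ℂ) ^ i * (k.choose i : ℂ)) • φ i := by
  rw [finsum_nat_eq_sum_range (K := k + 1)]
  · simp only [cbinom_natCast]
  · intro i hi
    rw [cbinom_natCast, Nat.choose_eq_zero_of_lt (by omega)]
    simp

lemma twWC_iff {k : ℕ} {u v : V} : TwWC p YM k u v ↔ ∀ w S,
    binP p k (prodSeq YM u v w S) = binP p k (revSeq YM u v w S) := by
  have key : ∀ (a b S : ℤ) (w : M), S = p * k - a - b - 2 * p →
      ((∑ᶠ i : ℕ, ((-1 : ℂ) ^ i * cbinom (k : ℂ) i) •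
        (YM u ((p : ℤ) * ((k : ℤ) - i) - a - p) * YM v ((p : ℤ) * i - b - p))) w =
          binP p k (prodSeq YM u v w S) (-a - p)) ∧
      ((∑ᶠ i : ℕ, ((-1 : ℂ) ^ i * cbinom (k : ℂ) i) •
          (YM v ((p : ℤ) * i - b - p) * YM u ((p : ℤ) * ((k : ℤ) - i) - a - p))) w =
          binP p k (revSeq YM u v w S) (-a - p)) := by
    intro a b S w hS
    have e1 : ∀ i : ℕ, -a - (p : ℤ) + p * ((k : ℤ) - i) = p * ((k : ℤ) - i) - a - p :=
      fun i => by ring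
    have e2 : ∀ i : ℕ, S - (p * ((k : ℤ) - i) - a - p) = p * (i : ℤ) - b - p :=
      fun i => by rw [hS]; ring
    rw [finsum_cbinom_natCast, finsum_cbinom_natCast, binP_natCast, binP_natCast]
    simp only [prodSeq, revSeq, e1, e2, LinearMap.sum_apply, LinearMap.smul_apply,
      Module.End.mul_apply, and_self]
  constructor
  · intro h w S
    ext x
    have := key (-x - p) (p * k - (-x - p) - 2 * p - S) S w (by ring)
    rw [h] at this
    have h2 := this.1.symm.trans this.2
    rwa [show -(-x - (p : ℤ)) - p = x by ring] at h2
  · intro h a b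
    ext w
    rw [(key a b _ w rfl).1, (key a b _ w rfl).2, h]

lemma twMWA_iff {k : ℕ} {u v : V} : TwMWA p 𝒜 ν ω YM k u v ↔ ∀ w S,
    iterSeq p 𝒜 ν YM u v w S = limCoeff p ω k (binP p k (prodSeq YM u v w S)) := by
  have key : ∀ (s n C S : ℤ) (w : M), S = p * k - 2 * p - C - p * n →
      ((∑ᶠ a : ℤ, (ω ^ (s * a) * cbinomZ ((a : ℂ) / (p : ℂ)) n) •
        (∑ᶠ i : ℕ, ((-1 : ℂ) ^ i * cbinom (k : ℂ) i) •
          YM u ((p : ℤ) * ((k : ℤ) - i) - a - p)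
            (YM v ((p : ℤ) * i - (C - a + (p : ℤ) * n) - p) w))) =
        limCoeff p ω k (binP p k (prodSeq YM u v w S)) (-s) (k - n - 1)) ∧
      YM (𝒜.Y ((ν ^ (-s)) u) ((k : ℤ) - n - 1) v) (-C - p) w =
        iterSeq p 𝒜 ν YM u v w S (-s) (k - n - 1) := by
    intro s n C S w hS
    constructor
    · rw [limCoeff]
      refine finsum_congr fun a => ?_
      rw [neg_neg, show (k : ℤ) - 1 - (k - n - 1) = n by ring, finsum_cbinom_natCast, binP_natCast]
      congr 1
      refine Finset.sum_congr rfl fun i _ => ?_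
      rw [prodSeq, show -a - (p : ℤ) + p * ((k : ℤ) - i) = p * ((k : ℤ) - i) - a - p by ring,
        show S - (p * ((k : ℤ) - i) - a - p) = p * (i : ℤ) - (C - a + p * n) - p by rw [hS]; ring]
    · rw [iterSeq, show S - (p : ℤ) * (k - n - 1) = -C - p by rw [hS]; ring]
  constructor
  · intro h w S
    ext s j
    have := key (-s) (k - 1 - j) (p * k - 2 * p - p * (k - 1 - j) - S) S w (by ring)
    rw [h (-s) _ _ w, neg_neg, show (k : ℤ) - (k - 1 - j) - 1 = j by ring] at this
    rw [← this.1, ← this.2]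
  · intro h s n C w
    rw [(key s n C _ w rfl).1, (key s n C _ w rfl).2, h]

/-- The twisted Jacobi identity and weak commutativity with exponent `k` give modified weak
associativity with exponent `k`. -/
lemma twMWA_of_twJacobi_of_twWC (hp : 0 < p) (hω : IsPrimitiveRoot ω p) (hν : ν ^ p = 1)
    (hT : TwTrunc YM) (hJ : TwJacobi p 𝒜 ν ω YM) {k : ℕ} {u v : V} (hc : TwWC p YM k u v) :
    TwMWA p 𝒜 ν ω YM k u v := by
  refine twMWA_iff.2 fun w S => ?_
  refine (twJacobi_iff.1 hJ u v w S).eq_limCoeff hp hω (prodSeq_zeroNearBot hT _ _ _ _)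
    (revSeq_zeroNearTop hT _ _ _ _) (iterSeq_unifZeroNearTop hp hν _ _ _ _)
    (fun s j => iterSeq_periodic hν _ _ _ _ _ _) ?_
  rw [twWC_iff.1 hc w S]
  ext a
  rw [binQ_natCast]

/-- The twisted Jacobi identity implies weak commutativity. -/
lemma exists_twWC_of_twJacobi (hp : 0 < p) (hν : ν ^ p = 1)
    (hJ : TwJacobi p 𝒜 ν ω YM) (u v : V) : ∃ k : ℕ, TwWC p YM k u v := by
  obtain ⟨B, hB⟩ := exists_unif_trunc 𝒜 hp hν u v
  refine ⟨B.toNat, twWC_iff.2 fun w S => ?_⟩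
  ext a
  rw [← binQ_natCast (f := revSeq YM u v w S), ← sub_eq_zero, twJacobi_iff.1 hJ u v w S, iterSide]
  have : ∀ r i : ℕ, iterSeq p 𝒜 ν YM u v w S r ((B.toNat : ℤ) + i) = 0 := fun r i => by
    rw [iterSeq, hB _ _ (by omega), map_zero]; rfl
  simp only [this, smul_zero, finsum_zero, Finset.sum_const_zero]

end ModeSequences

/-- Two properties closed under subtraction which cover a group do so one at a time. -/
lemma forall_or_forall_of_sub {A : Type*} [AddCommGroup A] {P Q : A → Prop}
    (hP : ∀ a b, P a → P b → P (a - b)) (hQ : ∀ a b, Q a → Q b → Q (a - b))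
    (h : ∀ a, P a ∨ Q a) : (∀ a, P a) ∨ ∀ a, Q a := by
  by_contra! hc
  obtain ⟨⟨x, hx⟩, y, hy⟩ := hc
  have hPy := (h y).resolve_right hy
  have hQx := (h x).resolve_left hx
  rcases h (x - y) with h1 | h1
  · have := hP _ _ h1 (hP _ _ (hP _ _ hPy hPy) hPy)
    rw [sub_self, zero_sub, sub_neg_eq_add, sub_add_cancel] at this
    exact hx this
  · have := hQ _ _ hQx h1
    rw [sub_sub_cancel] at this
    exact hy this

section Lines

variable {V M : Type} [AddCommGroup V] [Module ℂ V] [AddCommGroup M] [Module ℂ M]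

/-- The hypotheses of the equivalence theorem: truncation, weak commutativity with exponents
`k` and modified weak associativity with exponents `k'`. -/
structure AssocComm (p : ℕ) (𝒜 : VOA V) (ν : V ≃ₗ[ℂ] V) (ω : ℂ)
    (YM : V →ₗ[ℂ] ℤ → Module.End ℂ M) (k k' : V → V → ℕ) : Prop where
  pos : 0 < p
  root : IsPrimitiveRoot ω p
  per : ν ^ p = 1
  map_vac : ν 𝒜.vac = 𝒜.vac
  map_conf : ν 𝒜.conf = 𝒜.conf
  trunc : TwTrunc YM
  wc : ∀ u v, TwWC p YM (k u v) u v
  mwa : ∀ u v, TwMWA p 𝒜 ν ω YM (k' u v) u v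

/-- The twisted Jacobi identity for `u`, `v` applied to `w`, in total mode index `S`. -/
def LineJacobi (p : ℕ) (𝒜 : VOA V) (ν : V ≃ₗ[ℂ] V) (ω : ℂ) (YM : V →ₗ[ℂ] ℤ → Module.End ℂ M)
    (u v : V) (w : M) (S : ℤ) : Prop :=
  JacobiSeq p ω (prodSeq YM u v w S) (revSeq YM u v w S) (iterSeq p 𝒜 ν YM u v w S)

variable {p : ℕ} {𝒜 : VOA V} {ν : V ≃ₗ[ℂ] V} {ω : ℂ} {YM : V →ₗ[ℂ] ℤ → Module.End ℂ M}
  {k k' : V → V → ℕ}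

namespace AssocComm

variable (H : AssocComm p 𝒜 ν ω YM k k')
include H

lemma pos_int : (0 : ℤ) < p := by exact_mod_cast H.pos

lemma cast_ne_zero : (p : ℂ) ≠ 0 := by exact_mod_cast H.pos.ne'

lemma zpow_fix {x : V} (hx : ν x = x) (s : ℤ) : (ν ^ s) x = x := by
  have hx' : ∀ n : ℕ, (ν ^ n) x = x := fun n => by
    induction n with
    | zero => rfl
    | succ n ih => rw [pow_succ, LinearEquiv.mul_apply, hx, ih]
  obtain ⟨n, hn⟩ : ∃ n : ℕ, ν ^ s = ν ^ n := by
    refine ⟨(s % p).toNat, ?_⟩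
    rw [← zpow_natCast, Int.toNat_of_nonneg (Int.emod_nonneg s H.pos_int.ne')]
    conv_lhs => rw [← Int.emod_add_mul_ediv s p, zpow_add, zpow_mul, zpow_natCast, H.per, one_zpow,
      mul_one]
  rw [hn, hx' n]

lemma lineJacobi_or (u v : V) (w : M) (S : ℤ) :
    LineJacobi p 𝒜 ν ω YM u v w S ∨ iterSeq p 𝒜 ν YM u v w S = 0 :=
  jacobiSeq_or_eq_zero H.pos H.root (prodSeq_zeroNearBot H.trunc _ _ _ _)
    (revSeq_zeroNearTop H.trunc _ _ _ _) (twWC_iff.1 (H.wc u v) w S)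
    (twMWA_iff.1 (H.mwa u v) w S)

lemma prodSeq_eq_revSeq {u v : V} {w : M} {S : ℤ} (h : ZeroNearTop (prodSeq YM u v w S)) :
    prodSeq YM u v w S = revSeq YM u v w S :=
  eq_of_binP_eq_binP H.pos h (revSeq_zeroNearTop H.trunc _ _ _ _) (twWC_iff.1 (H.wc u v) w S)

lemma lineJacobi_of_zeroNearTop {u v : V} {w : M} {S : ℤ}
    (h : ZeroNearTop (prodSeq YM u v w S)) : LineJacobi p 𝒜 ν ω YM u v w S :=
  jacobiSeq_of_binP_zeroNearTop H.pos H.root (prodSeq_zeroNearBot H.trunc _ _ _ _)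
    (revSeq_zeroNearTop H.trunc _ _ _ _) (twWC_iff.1 (H.wc u v) w S)
    (twMWA_iff.1 (H.mwa u v) w S) (h.binP_natCast _)

lemma jacobiSeq_sub {u v u₁ v₁ : V} {w w₁ : M} {S : ℤ}
    (h : LineJacobi p 𝒜 ν ω YM u v w S) (h₁ : LineJacobi p 𝒜 ν ω YM u₁ v₁ w₁ S) :
    JacobiSeq p ω (prodSeq YM u v w S - prodSeq YM u₁ v₁ w₁ S)
      (revSeq YM u v w S - revSeq YM u₁ v₁ w₁ S)
      (iterSeq p 𝒜 ν YM u v w S - iterSeq p 𝒜 ν YM u₁ v₁ w₁ S) :=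
  JacobiSeq.sub H.pos h h₁ (prodSeq_zeroNearBot H.trunc _ _ _ _)
    (revSeq_zeroNearTop H.trunc _ _ _ _) (iterSeq_unifZeroNearTop H.pos H.per _ _ _ _)
    (prodSeq_zeroNearBot H.trunc _ _ _ _)
    (revSeq_zeroNearTop H.trunc _ _ _ _) (iterSeq_unifZeroNearTop H.pos H.per _ _ _ _)

/-- In each total mode index, either the twisted Jacobi identity holds throughout or all
iterates vanish. -/
lemma forall_lineJacobi_or (S : ℤ) : (∀ u v w, LineJacobi p 𝒜 ν ω YM u v w S) ∨
    ∀ u v w, iterSeq p 𝒜 ν YM u v w S = 0 := by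
  refine forall_or_forall_of_sub (fun u u' h h' v w => ?_) (fun u u' h h' v w => ?_) fun u => ?_
  · convert H.jacobiSeq_sub (h v w) (h' v w) using 1
    rw [LineJacobi]
    congr! 1 <;> ext <;> simp [prodSeq, revSeq, iterSeq]
  · rw [show iterSeq p 𝒜 ν YM (u - u') v w S
      = iterSeq p 𝒜 ν YM u v w S - iterSeq p 𝒜 ν YM u' v w S by
        ext; simp [iterSeq], h, h', sub_zero]
  refine forall_or_forall_of_sub (fun v v' h h' w => ?_) (fun v v' h h' w => ?_) fun v => ?_
  · convert H.jacobiSeq_sub (h w) (h' w) using 1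
    rw [LineJacobi]
    congr! 1 <;> ext <;> simp [prodSeq, revSeq, iterSeq]
  · rw [show iterSeq p 𝒜 ν YM u (v - v') w S
      = iterSeq p 𝒜 ν YM u v w S - iterSeq p 𝒜 ν YM u v' w S by
        ext; simp [iterSeq], h, h', sub_zero]
  refine forall_or_forall_of_sub (fun w w' h h' => ?_) (fun w w' h h' => ?_) fun w =>
    H.lineJacobi_or u v w S
  · convert H.jacobiSeq_sub h h' using 1
    rw [LineJacobi]
    congr! 1 <;> ext <;> simp [prodSeq, revSeq, iterSeq]
  · rw [show iterSeq p 𝒜 ν YM u v (w - w') S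
      = iterSeq p 𝒜 ν YM u v w S - iterSeq p 𝒜 ν YM u v w' S by
        ext; simp [iterSeq], h, h', sub_zero]

lemma iterSeq_vac_left (v : V) (w : M) (S s j : ℤ) :
    iterSeq p 𝒜 ν YM 𝒜.vac v w S s j = if j = -1 then YM v (S + p) w else 0 := by
  rw [iterSeq, H.zpow_fix H.map_vac, 𝒜.vacuum]
  split_ifs with h
  · rw [h, Module.End.one_apply, show S - (p : ℤ) * -1 = S + p by ring]
  · simp

lemma mode_eq_zero {S : ℤ} (h : ∀ u v w, iterSeq p 𝒜 ν YM u v w S = 0) (x : V) :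
    YM x (S + p) = 0 := by
  ext w
  have := congrFun (congrFun (h 𝒜.vac x w) 0) (-1)
  rwa [H.iterSeq_vac_left, if_pos rfl] at this

lemma prodSeq_vac_left_of_lineJacobi {v : V} {w : M} {S : ℤ}
    (h : LineJacobi p 𝒜 ν ω YM 𝒜.vac v w S) :
    prodSeq YM 𝒜.vac v w S = Finsupp.single (-(p : ℤ)) (YM v (S + p) w) := by
  set m := YM v (S + p) w with hm
  have hγ : iterSeq p 𝒜 ν YM 𝒜.vac v w S = limCoeff p ω 0 (Finsupp.single (-(p : ℤ)) m) := by
    ext s j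
    have hpC := H.cast_ne_zero
    rw [H.iterSeq_vac_left, limCoeff_single, neg_add_cancel, mul_zero, zpow_zero, one_mul]
    have : (-((-(p : ℤ) : ℤ) : ℂ) / p - p / p) = 0 := by push_cast; ring
    rw [this]
    split_ifs with hj
    · rw [hj, show (0 : ℤ) - 1 - -1 = 0 by norm_num, cbinomZ_zero_right, one_smul]
    · rcases lt_or_ge (0 - 1 - j) 0 with h0 | h0
      · rw [cbinomZ_of_neg _ h0, zero_smul]
      · obtain ⟨n, hn⟩ := Int.eq_ofNat_of_zero_le h0
        rw [hn, cbinomZ_natCast, cbinom_zero_left (by omega), zero_smul]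
  have hJ' : JacobiSeq p ω (Finsupp.single (-(p : ℤ)) m) (Finsupp.single (-(p : ℤ)) m)
      (iterSeq p 𝒜 ν YM 𝒜.vac v w S) := by
    rw [hγ]
    intro n a
    rw [jacobiSeq_finsupp H.pos H.root 0, zero_add]
  have := JacobiSeq.sub H.pos h hJ' (prodSeq_zeroNearBot H.trunc _ _ _ _)
    (revSeq_zeroNearTop H.trunc _ _ _ _) (iterSeq_unifZeroNearTop H.pos H.per _ _ _ _)
    (finsupp_zeroNearBot _) (finsupp_zeroNearTop _)
    (iterSeq_unifZeroNearTop H.pos H.per _ _ _ _)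
  rw [sub_self] at this
  refine sub_eq_zero.1 (this.eq_zero_of_iter_eq_zero H.pos ?_ ?_)
  · obtain ⟨B, hB⟩ := prodSeq_zeroNearBot H.trunc 𝒜.vac v w S
    obtain ⟨C, hC⟩ := finsupp_zeroNearBot (Finsupp.single (-(p : ℤ)) m)
    exact ⟨min B C, fun N hN => by
      rw [Pi.sub_apply, hB N (by omega), hC N (by omega), sub_zero]⟩
  · obtain ⟨B, hB⟩ := revSeq_zeroNearTop H.trunc 𝒜.vac v w S
    obtain ⟨C, hC⟩ := finsupp_zeroNearTop (Finsupp.single (-(p : ℤ)) m)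
    exact ⟨max B C, fun N hN => by
      rw [Pi.sub_apply, hB N (by omega), hC N (by omega), sub_zero]⟩

lemma vac_mul_mode_self (v : V) (N : ℤ) (w : M) : YM 𝒜.vac (-p) (YM v N w) = YM v N w := by
  rcases H.forall_lineJacobi_or (N - p) with h | h
  · have := congrFun (H.prodSeq_vac_left_of_lineJacobi (h 𝒜.vac v w)) (-p)
    rw [prodSeq, Finsupp.single_eq_same] at this
    rwa [show N - (p : ℤ) - -p = N by ring, sub_add_cancel] at this
  · have := H.mode_eq_zero h v
    rw [sub_add_cancel] at this
    rw [this, LinearMap.zero_apply, map_zero]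

lemma vac_mul_mode {K : ℤ} (hK : K ≠ -p) (v : V) (N : ℤ) (w : M) :
    YM 𝒜.vac K (YM v N w) = 0 := by
  rw [← H.vac_mul_mode_self v N w]
  rcases H.forall_lineJacobi_or (K - p) with h | h
  · have := congrFun (H.prodSeq_vac_left_of_lineJacobi (h 𝒜.vac 𝒜.vac (YM v N w))) K
    rwa [prodSeq, Finsupp.single_eq_of_ne hK, show K - (p : ℤ) - K = -p by ring] at this
  · have := H.mode_eq_zero h 𝒜.vac
    rw [sub_add_cancel] at this
    rw [this, LinearMap.zero_apply]

lemma mode_mul_vac (v : V) (K N : ℤ) (w : M) :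
    YM v N (YM 𝒜.vac K w) = if K = -p then YM v N w else 0 := by
  have h1 : ZeroNearTop (prodSeq YM 𝒜.vac v w (N + K)) :=
    ⟨-p + 1, fun L hL => H.vac_mul_mode (by omega) _ _ _⟩
  have := congrFun (H.prodSeq_eq_revSeq h1) K
  rw [prodSeq, revSeq, add_sub_cancel_right] at this
  rw [← this]
  split_ifs with h
  · rw [h, H.vac_mul_mode_self]
  · exact H.vac_mul_mode h _ _ _

lemma vac_mode {K : ℤ} (hK : K ≠ -p) : YM 𝒜.vac K = 0 := by
  ext w
  rw [← H.vac_mul_mode_self 𝒜.vac K w, H.mode_mul_vac, if_neg hK, LinearMap.zero_apply]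

/-- The `L(-1)`-derivative property. -/
lemma deriv_mode (u : V) (N : ℤ) :
    YM (𝒜.Y 𝒜.conf 0 u) N = (-(N : ℂ) / (p : ℂ)) • YM u (N - p) := by
  have hder : 𝒜.Y u (-2) 𝒜.vac = 𝒜.Y 𝒜.conf 0 u := by
    have := LinearMap.congr_fun (𝒜.L_neg_one u (-1)) 𝒜.vac
    rw [𝒜.creation_id] at this
    rw [this]
    norm_num
  ext w
  set S := N - 2 * p with hS
  have hprod : prodSeq YM u 𝒜.vac w S = Finsupp.single (S + p) (YM u (S + p) w) := by
    ext L
    rw [prodSeq, H.mode_mul_vac]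
    by_cases hL : L = S + p
    · rw [if_pos (by omega), hL, Finsupp.single_eq_same]
    · rw [if_neg (by omega), Finsupp.single_eq_of_ne hL]
  have htop : ZeroNearTop (prodSeq YM u 𝒜.vac w S) := by
    rw [hprod]; exact finsupp_zeroNearTop _
  have hJ := H.lineJacobi_of_zeroNearTop htop
  have := JacobiSeq.eq_limCoeff (k := 0) H.pos H.root hJ (prodSeq_zeroNearBot H.trunc _ _ _ _)
    (revSeq_zeroNearTop H.trunc _ _ _ _) (iterSeq_unifZeroNearTop H.pos H.per _ _ _ _)
    (fun s j => iterSeq_periodic H.per _ _ _ _ _ _)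
    (by rw [Nat.cast_zero, binP_zero, binQ_zero]; exact H.prodSeq_eq_revSeq htop)
  rw [Nat.cast_zero, binP_zero, hprod] at this
  have h2 := congrFun (congrFun this 0) (-2)
  rw [limCoeff_single, iterSeq, zpow_zero, LinearEquiv.coe_one, id, hder, zero_mul, zpow_zero,
    one_mul, show S - p * -2 = N by rw [hS]; ring, show (0 : ℤ) - 1 - -2 = 1 by norm_num,
    cbinomZ_one_right] at h2
  rw [h2, LinearMap.smul_apply, show S + p = N - p by rw [hS]; ring]
  congr 1
  push_cast
  ring

end AssocComm

end Lines

section ConformalProducts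

variable {V : Type} [AddCommGroup V] [Module ℂ V] (𝒜 : VOA V)

lemma VOA.conf_mode_conf (m : ℤ) (hm : 0 ≤ m) : 𝒜.Y 𝒜.conf m 𝒜.conf
    = ((m + 1 : ℤ) : ℂ) • 𝒜.Y 𝒜.conf (m - 2) 𝒜.vac
      + (if m = 3 then 𝒜.cc / 2 else 0) • 𝒜.vac := by
  have h := LinearMap.congr_fun (𝒜.virasoro (m - 1) (-2)) 𝒜.vac
  simp only [LinearMap.sub_apply, LinearMap.add_apply, LinearMap.smul_apply, Module.End.mul_apply,
    Module.End.one_apply] at h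
  rw [show m - 1 + 1 = m by ring, show (-2 : ℤ) + 1 = -1 by norm_num, 𝒜.creation_id,
    𝒜.creation_zero 𝒜.conf m hm, map_zero, sub_zero, show m - 1 + -2 + 1 = m - 2 by ring,
    show m - 1 - -2 = m + 1 by ring] at h
  rw [h]
  congr 2
  by_cases h3 : m = 3
  · rw [if_pos (by omega), if_pos h3, h3]; norm_num; ring
  · rw [if_neg (by omega), if_neg h3]

lemma VOA.conf_one_conf : 𝒜.Y 𝒜.conf 1 𝒜.conf = (2 : ℂ) • 𝒜.conf := by
  rw [𝒜.conf_mode_conf 1 (by norm_num), show (1 : ℤ) - 2 = -1 by norm_num, 𝒜.creation_id]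
  norm_num

lemma VOA.conf_two_conf : 𝒜.Y 𝒜.conf 2 𝒜.conf = 0 := by
  rw [𝒜.conf_mode_conf 2 (by norm_num), 𝒜.creation_zero _ _ (by norm_num)]
  norm_num

lemma VOA.conf_three_conf : 𝒜.Y 𝒜.conf 3 𝒜.conf = (𝒜.cc / 2) • 𝒜.vac := by
  rw [𝒜.conf_mode_conf 3 (by norm_num), 𝒜.creation_zero _ _ (by norm_num)]
  norm_num

lemma VOA.conf_mode_conf_of_ge (m : ℤ) (hm : 4 ≤ m) : 𝒜.Y 𝒜.conf m 𝒜.conf = 0 := by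
  rw [𝒜.conf_mode_conf m (by omega), 𝒜.creation_zero _ _ (by omega), if_neg (by omega)]
  simp

end ConformalProducts

section ConformalModes

variable {V M : Type} [AddCommGroup V] [Module ℂ V] [AddCommGroup M] [Module ℂ M]
  {p : ℕ} {𝒜 : VOA V} {ν : V ≃ₗ[ℂ] V} {ω : ℂ} {YM : V →ₗ[ℂ] ℤ → Module.End ℂ M}
  {k k' : V → V → ℕ}

namespace AssocComm

variable (H : AssocComm p 𝒜 ν ω YM k k')
include H

lemma conf_comm_of_lineJacobi {v : V} {w : M} {n N : ℤ}
    (h : LineJacobi p 𝒜 ν ω YM 𝒜.conf v w (N + p * n)) :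
    YM 𝒜.conf (p * n) (YM v N w) - YM v N (YM 𝒜.conf (p * n) w)
      = ∑ᶠ i : ℕ, cbinom (n : ℂ) i • YM (𝒜.Y 𝒜.conf i v) (N + p * n - p * i) w := by
  have hpC := H.cast_ne_zero
  have h0 := h 0 (p * n)
  rw [binP_zero, binQ_zero, prodSeq, revSeq, add_sub_cancel_right, iterSide] at h0
  rw [h0]
  have h1 : ∀ r : ℕ, ω ^ (-(r : ℤ) * (p * n)) = 1 := fun r => by
    rw [show -(r : ℤ) * (p * n) = p * (-r * n) by ring, zpow_mul, zpow_natCast, H.root.pow_eq_one,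
      one_zpow]
  have h2 : (((p : ℤ) * n : ℤ) : ℂ) / p = n := by
    push_cast; field_simp
  simp only [h1, h2, one_smul, iterSeq, H.zpow_fix H.map_conf, zero_add, Finset.sum_const,
    Finset.card_range]
  rw [← Nat.cast_smul_eq_nsmul ℂ, smul_smul, inv_mul_cancel₀ hpC, one_smul]

lemma lineJacobi_of_conf_zero (h : YM 𝒜.conf 0 = 0) (u v : V) (w : M) (S : ℤ) :
    LineJacobi p 𝒜 ν ω YM u v w S := by
  have hD : ∀ (x : V) (N : ℤ), YM (𝒜.Y 𝒜.conf 0 x) N = 0 := fun x N => by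
    ext w
    rw [LinearMap.zero_apply]
    rcases H.lineJacobi_or 𝒜.conf x w N with hJ | hJ
    · have := H.conf_comm_of_lineJacobi (n := 0) (N := N) (by simpa using hJ)
      rw [mul_zero, h, finsum_nat_eq_sum_range (K := 1)] at this
      · simpa using this.symm
      · intro i hi
        rw [Int.cast_zero, cbinom_zero_left (by omega), zero_smul]
    · have := congrFun (congrFun hJ 0) 0
      simpa [iterSeq] using this
  have hN : ∀ (x : V) (N : ℤ), N ≠ -p → YM x N = 0 := fun x N hN => by
    have := H.deriv_mode x (N + p)
    rw [hD, add_sub_cancel_right, eq_comm, smul_eq_zero] at this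
    refine this.resolve_left (div_ne_zero (neg_ne_zero.2 ?_) H.cast_ne_zero)
    exact_mod_cast fun h' => hN (by omega)
  exact H.lineJacobi_of_zeroNearTop ⟨-p + 1, fun N hN' => by
    rw [prodSeq, hN u N (by omega), LinearMap.zero_apply]⟩

lemma mode_eq_zero_of_descend {N : ℤ} (hN : N ≠ 0) (h : ∀ x, YM x N = 0) (x : V) :
    YM x (N - p) = 0 := by
  have := H.deriv_mode x N
  rw [h, eq_comm, smul_eq_zero] at this
  refine this.resolve_left (div_ne_zero (neg_ne_zero.2 ?_) H.cast_ne_zero)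
  exact_mod_cast hN

lemma conf_comm_conf_of_lineJacobi {w : M} {n N : ℤ}
    (h : LineJacobi p 𝒜 ν ω YM 𝒜.conf 𝒜.conf w (N + p * n)) :
    YM 𝒜.conf (p * n) (YM 𝒜.conf N w) - YM 𝒜.conf N (YM 𝒜.conf (p * n) w)
      = (-(N + p * n : ℂ) / p + 2 * n) • YM 𝒜.conf (N + p * n - p) w
        + (cbinom (n : ℂ) 3 * (𝒜.cc / 2)) • YM 𝒜.vac (N + p * n - 3 * p) w := by
  rw [H.conf_comm_of_lineJacobi h, finsum_nat_eq_sum_range (K := 4)]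
  · simp only [Finset.sum_range_succ, Finset.sum_range_zero, zero_add, Nat.cast_zero, Nat.cast_one,
      Nat.cast_ofNat, cbinom_zero_right, cbinom_one_right, mul_zero, sub_zero, mul_one,
      𝒜.conf_one_conf, 𝒜.conf_two_conf, 𝒜.conf_three_conf, map_zero, map_smul, Pi.smul_apply,
      LinearMap.smul_apply, Pi.zero_apply, LinearMap.zero_apply, smul_zero, add_zero, smul_smul,
      H.deriv_mode]
    rw [← add_smul, mul_comm (p : ℤ) 3]
    congr 2
    push_cast
    ring
  · intro i hi
    rw [𝒜.conf_mode_conf_of_ge i (by omega)]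
    simp

lemma lineJacobi_of_dvd (u v : V) (w : M) (b : ℤ) : LineJacobi p 𝒜 ν ω YM u v w (p * b) := by
  have hp := H.pos_int
  have descend : ∀ c : ℕ, (∀ x, YM x (p * c) = 0) → ∀ x, YM x 0 = 0 := fun c => by
    induction c with
    | zero => simp
    | succ c ih =>
      intro h
      refine ih fun x => ?_
      have := H.mode_eq_zero_of_descend (by positivity) h x
      rwa [show (p : ℤ) * ((c + 1 : ℕ) : ℤ) - p = p * c by push_cast; ring] at this
  rcases H.forall_lineJacobi_or (p * b) with h | h
  · exact h u v w
  have h0 := H.mode_eq_zero h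
  refine H.lineJacobi_of_conf_zero ?_ u v w _
  rcases le_or_gt 0 (b + 1) with hb | hb
  · obtain ⟨c, hc⟩ := Int.eq_ofNat_of_zero_le hb
    refine descend c (fun x => ?_) _
    rw [← h0 x, ← hc, mul_add, mul_one]
  · rcases H.forall_lineJacobi_or p with h1 | h1
    · have hc0 : YM 𝒜.conf (p * (b + 1)) = 0 := by
        rw [← h0 𝒜.conf, mul_add, mul_one]
      ext w
      have := H.conf_comm_conf_of_lineJacobi (w := w) (n := -b) (N := p * (b + 1))
        (by rw [show (p : ℤ) * (b + 1) + p * -b = p by ring]; exact h1 _ _ _)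
      rw [show (p : ℤ) * (b + 1) + p * -b = p by ring, hc0, sub_self,
        H.vac_mode (show (p : ℤ) - 3 * p ≠ -p by omega)] at this
      simp only [LinearMap.zero_apply, map_zero, sub_zero, smul_zero, add_zero] at this
      rw [eq_comm, smul_eq_zero] at this
      refine this.resolve_left fun h' => ?_
      have hpC := H.cast_ne_zero
      push_cast at h'
      field_simp at h'
      have h2 : ((-2 * b - 1 : ℤ) : ℂ) = 0 := by push_cast; linear_combination h'
      have h3 : (-2 * b - 1 : ℤ) = 0 := by exact_mod_cast h2
      omega
    · refine descend 2 (fun x => ?_) _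
      rw [← H.mode_eq_zero h1 x, Nat.cast_ofNat, mul_two]

/-- If the twisted Jacobi identity fails in total mode index `S`, then all modes whose index is
congruent to `S` vanish. -/
lemma mode_eq_zero_of_modEq {S : ℤ} (h : ¬ ∀ u v w, LineJacobi p 𝒜 ν ω YM u v w S) {N : ℤ}
    (hN : (p : ℤ) ∣ N - S) (x : V) : YM x N = 0 := by
  have hp := H.pos_int
  have hS : ¬ (p : ℤ) ∣ S := by
    rintro ⟨b, rfl⟩
    exact h fun u v w => H.lineJacobi_of_dvd u v w b
  have h0 := H.mode_eq_zero ((H.forall_lineJacobi_or S).resolve_left h)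
  have hne : ∀ c : ℤ, S + p * c ≠ 0 := fun c hc => hS ⟨-c, by linarith⟩
  have descend : ∀ (c : ℤ), (∀ x, YM x (S + p * c) = 0) → ∀ (j : ℕ) (x : V),
      YM x (S + p * (c - j)) = 0 := fun c hc j => by
    induction j with
    | zero => simpa using hc
    | succ j ih =>
      intro x
      have := H.mode_eq_zero_of_descend (hne _) ih x
      rwa [show S + (p : ℤ) * (c - j) - p = S + p * (c - ((j + 1 : ℕ) : ℤ)) by push_cast; ring]
        at this
  have descend' : ∀ c d : ℤ, d ≤ c → (∀ x, YM x (S + p * c) = 0) → ∀ x, YM x (S + p * d) = 0 :=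
    fun c d hdc hc x => by
      have := descend c hc (c - d).toNat x
      rwa [Int.toNat_of_nonneg (by omega), sub_sub_cancel] at this
  have step : ∀ c : ℤ, (∀ x, YM x (S + p * c) = 0) → ∀ x, YM x (S + p * (c + 1)) = 0 := by
    intro c hc
    rcases H.forall_lineJacobi_or (S + p * (c + 2)) with hJ | hJ
    · intro y
      ext w
      have comm : ∀ n : ℤ, 2 ≤ n → (-(S + p * (c + 2) : ℂ) / p) • YM y (S + p * (c + 1)) w
          + (n : ℂ) • YM (𝒜.Y 𝒜.conf 1 y) (S + p * (c + 1)) w = 0 := fun n hn => by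
        have h1 := H.conf_comm_of_lineJacobi (w := w) (v := y) (n := n) (N := S + p * (c + 2 - n))
          (by rw [show S + (p : ℤ) * (c + 2 - n) + p * n = S + p * (c + 2) by ring]; exact hJ _ _ _)
        rw [descend' c (c + 2 - n) (by omega) hc, LinearMap.zero_apply, LinearMap.zero_apply,
          map_zero, sub_zero, finsum_nat_eq_sum_range (K := 2)] at h1
        · rw [h1]
          simp only [Finset.sum_range_succ, Finset.sum_range_zero, zero_add, Nat.cast_zero,
            Nat.cast_one, cbinom_zero_right, cbinom_one_right, mul_zero, sub_zero, mul_one,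
            one_smul, H.deriv_mode, LinearMap.smul_apply]
          rw [show S + (p : ℤ) * (c + 2 - n) + p * n = S + p * (c + 2) by ring,
            show S + (p : ℤ) * (c + 2) - p = S + p * (c + 1) by ring]
          push_cast
          rfl
        · intro i hi
          rw [show S + (p : ℤ) * (c + 2 - n) + p * n - p * i = S + p * (c + 2 - i) by ring,
            descend' c (c + 2 - i) (by omega) hc, LinearMap.zero_apply, smul_zero]
      have h2 := comm 2 le_rfl
      have h3 := comm 3 (by norm_num)
      have h4 : YM (𝒜.Y 𝒜.conf 1 y) (S + p * (c + 1)) w = 0 := by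
        rw [← sub_eq_zero.2 (h3.trans h2.symm)]
        push_cast
        module
      rw [h4, smul_zero, add_zero, smul_eq_zero] at h2
      refine h2.resolve_left (div_ne_zero (neg_ne_zero.2 ?_) H.cast_ne_zero)
      exact_mod_cast hne (c + 2)
    · refine descend' (c + 3) _ (by omega) fun x => ?_
      rw [← H.mode_eq_zero hJ x, show S + (p : ℤ) * (c + 3) = S + p * (c + 2) + p by ring]
  have up : ∀ (j : ℕ) (x : V), YM x (S + p * (1 + j)) = 0 := fun j => by
    induction j with
    | zero => simpa using h0
    | succ j ih =>
      rw [Nat.cast_succ, ← add_assoc]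
      exact step _ ih
  obtain ⟨d, hd⟩ := hN
  rw [show N = S + p * d by linarith]
  exact descend' (1 + d.toNat) d (by omega) (up _) x

/-- The commutator formula with the modes of the conformal vector of integral index. -/
lemma conf_comm (v : V) (w : M) (n N : ℤ) :
    YM 𝒜.conf (p * n) (YM v N w) - YM v N (YM 𝒜.conf (p * n) w)
      = ∑ᶠ i : ℕ, cbinom (n : ℂ) i • YM (𝒜.Y 𝒜.conf i v) (N + p * n - p * i) w := by
  by_cases h : ∀ u v w, LineJacobi p 𝒜 ν ω YM u v w (N + p * n)
  · exact H.conf_comm_of_lineJacobi (h _ _ _)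
  · have h0 : ∀ i : ℕ, YM (𝒜.Y 𝒜.conf i v) (N + p * n - p * i) = 0 := fun i =>
      H.mode_eq_zero_of_modEq h ⟨-i, by ring⟩ _
    simp only [h0, H.mode_eq_zero_of_modEq h (N := N) ⟨-n, by ring⟩, LinearMap.zero_apply,
      map_zero, smul_zero, finsum_zero, sub_zero]

end AssocComm

end ConformalModes

section Ladder

variable {M : Type} [AddCommGroup M] [Module ℂ M] {p : ℕ}

/-- The coefficient in the commutator of the `j`-th lowering operator with the mode of index `N`
of a vector of weight `h`. -/
def ladderCoeff (p : ℕ) (h j N : ℤ) : ℂ := (1 - j) * (h - 1) - N / p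

/-- The commutation relations of the operators `l j` with a product of two modes of weights
`h₁`, `h₂`, in total mode indices congruent to `R`. -/
def LadderComm (p : ℕ) (R h₁ h₂ : ℤ) (l : ℤ → Module.End ℂ M) (B : ℤ → ℤ → Module.End ℂ M) :
    Prop :=
  ∀ (j N K : ℤ) (w : M), (p : ℤ) ∣ N + K - R →
    B N K (l j w) = l j (B N K w) - ladderCoeff p h₁ j N • B (N - p * j) K w
      - ladderCoeff p h₂ j K • B N (K - p * j) w

lemma ladderCoeff_ne_zero (hp : 0 < p) {h j N : ℤ} (hN : ¬ (p : ℤ) ∣ N) :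
    ladderCoeff p h j N ≠ 0 := by
  intro h0
  have hpC : (p : ℂ) ≠ 0 := by exact_mod_cast hp.ne'
  rw [ladderCoeff, sub_eq_zero, eq_div_iff hpC] at h0
  refine hN ⟨(1 - j) * (h - 1), ?_⟩
  have : (N : ℂ) = ((p * ((1 - j) * (h - 1)) : ℤ) : ℂ) := by
    rw [← h0]; push_cast; ring
  exact_mod_cast this

lemma LadderComm.apply_apply (hp : 0 < p) {R h₁ h₂ : ℤ} {l : ℤ → Module.End ℂ M}
    {B : ℤ → ℤ → Module.End ℂ M} (hB : LadderComm p R h₁ h₂ l B) {w : M} {S : ℤ}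
    (hS : (p : ℤ) ∣ S - R) (hw : ∀ N K : ℤ, (p : ℤ) ∣ N + K - R → S < N + K → B N K w = 0)
    {j i : ℤ} (hj : 0 < j) (hi : 0 < i) {N K : ℤ} (hNK : N + K = S + p * (j + i)) :
    B N K (l j (l i w)) =
      (ladderCoeff p h₁ j N * ladderCoeff p h₁ i (N - p * j)) • B (N - p * (j + i)) K w
      + (ladderCoeff p h₁ j N * ladderCoeff p h₂ i K) • B (N - p * j) (K - p * i) w
      + (ladderCoeff p h₂ j K * ladderCoeff p h₁ i N) • B (N - p * i) (K - p * j) w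
      + (ladderCoeff p h₂ j K * ladderCoeff p h₂ i (K - p * j)) • B N (K - p * (j + i)) w := by
  have hp' : (0 : ℤ) < p := by exact_mod_cast hp
  have hpj := mul_pos hp' hj
  have hpi := mul_pos hp' hi
  obtain ⟨c, hc⟩ := hS
  have d1 : (p : ℤ) ∣ N + K - R := ⟨c + (j + i), by linear_combination hc + hNK⟩
  have d2 : (p : ℤ) ∣ N - p * j + K - R := ⟨c + i, by linear_combination hc + hNK⟩
  have d3 : (p : ℤ) ∣ N + (K - p * j) - R := ⟨c + i, by linear_combination hc + hNK⟩
  have d4 : (p : ℤ) ∣ N - p * i + K - R := ⟨c + j, by linear_combination hc + hNK⟩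
  have d5 : (p : ℤ) ∣ N + (K - p * i) - R := ⟨c + j, by linear_combination hc + hNK⟩
  rw [hB j N K _ d1, hB i N K _ d1, hB i _ K _ d2, hB i N _ _ d3, hw _ _ d1 (by linarith),
    hw _ _ d2 (by linarith), hw _ _ d3 (by linarith), hw _ _ d4 (by linarith),
    hw _ _ d5 (by linarith)]
  simp only [map_zero, smul_zero, sub_zero, zero_sub]
  rw [show N - (p : ℤ) * j - p * i = N - p * (j + i) by ring,
    show K - (p : ℤ) * j - p * i = K - p * (j + i) by ring]
  module

lemma exists_fin_relation {T : Type*} [AddCommGroup T] [Module ℂ T] [FiniteDimensional ℂ T]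
    (ψ : Fin (Module.finrank ℂ T + 1) → T) :
    ∃ b : Fin (Module.finrank ℂ T + 1) → ℂ, ∑ i, b i • ψ i = 0 ∧ ∃ i, b i ≠ 0 := by
  refine Fintype.not_linearIndependent_iff.1 fun h => ?_
  have := h.fintype_card_le_finrank
  rw [Fintype.card_fin] at this
  omega

/-- If a combination of two lowering operators makes the commutator vanish, and with it the
product, then the product vanished to begin with. -/
lemma eq_zero_of_ladderComm (hp : 0 < p) {R h₁ h₂ S : ℤ} {k : ℕ} {l : ℤ → Module.End ℂ M}
    {F D : ℤ → ℤ → Module.End ℂ M} (hF : LadderComm p R h₁ h₂ l F)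
    (hD : LadderComm p R h₁ h₂ l D) {w : M} (hS : (p : ℤ) ∣ S - R)
    (hFw : ∀ N K : ℤ, (p : ℤ) ∣ N + K - R → S < N + K → F N K w = 0)
    (hDw : ∀ N K : ℤ, (p : ℤ) ∣ N + K - R → S < N + K → D N K w = 0)
    (hdiff : ∀ (T : ℤ) (w' : M), (p : ℤ) ∣ T - R → binP p k (fun N => D N (T - N) w') = 0)
    (hconcl : ∀ (T : ℤ) (w' : M), (p : ℤ) ∣ T - R → (∀ N, D N (T - N) w' = 0) →
      ∀ N, F N (T - N) w' = 0)
    (hbot : ZeroNearBot fun N => F N (S - N) w)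
    (hdvd : ∀ N : ℤ, (p : ℤ) ∣ N → F N (S - N) w = 0)
    (hdvd' : ∀ N : ℤ, (p : ℤ) ∣ S - N → F N (S - N) w = 0) (N : ℤ) : F N (S - N) w = 0 := by
  have hp' : (0 : ℤ) < p := by exact_mod_cast hp
  have hpC : (p : ℂ) ≠ 0 := by exact_mod_cast hp.ne'
  by_contra hne
  obtain ⟨C, hC⟩ := hbot
  obtain ⟨N₀, hN₀, hmin⟩ := Int.exists_least_of_bdd (P := fun N => F N (S - N) w ≠ 0)
    ⟨C, fun z hz => by by_contra h; exact hz (hC z (by omega))⟩ ⟨N, hne⟩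
  have hlt : ∀ z < N₀, F z (S - z) w = 0 := fun z hz => by
    by_contra h
    exact absurd (hmin z h) (by omega)
  let X : Submodule ℂ M := Submodule.span ℂ (Set.range fun i : Fin (p * k) => D i (S - i) w)
  have hX : ∀ N, D N (S - N) w ∈ X := fun N => by
    refine mem_of_window hp (hdiff S w hS) X (fun L h0 h1 => Submodule.subset_span ?_) N
    refine ⟨⟨L.toNat, by zify; omega⟩, ?_⟩
    simp only [Int.toNat_of_nonneg h0]
  have : FiniteDimensional ℂ X := FiniteDimensional.span_of_finite ℂ (Set.finite_range _)
  set J := Module.finrank ℂ ((Fin (p * k) → X) × (Fin 3 → ℂ)) + 1 with hJ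
  let n : ℤ := 2 * J + 2
  let T : ℤ := S + p * n
  obtain ⟨e, he⟩ := hS
  have hT : (p : ℤ) ∣ T - R := ⟨e + n, by simp only [T]; linear_combination he⟩
  have hpos : ∀ i : Fin J, (0 : ℤ) < (i : ℤ) + 1 ∧ (0 : ℤ) < n - ((i : ℤ) + 1) := fun i => by
    have := i.2
    simp only [n]
    omega
  have expand : ∀ {B : ℤ → ℤ → Module.End ℂ M}, LadderComm p R h₁ h₂ l B →
      (∀ N K : ℤ, (p : ℤ) ∣ N + K - R → S < N + K → B N K w = 0) → ∀ (i : Fin J) (N : ℤ),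
      B N (T - N) (l (i + 1) (l (n - (i + 1)) w)) =
      (ladderCoeff p h₁ (i + 1) N * ladderCoeff p h₁ (n - (i + 1)) (N - p * (i + 1))) •
        B (N - p * n) (S - (N - p * n)) w
      + (ladderCoeff p h₁ (i + 1) N * ladderCoeff p h₂ (n - (i + 1)) (T - N)) •
        B (N - p * (i + 1)) (S - (N - p * (i + 1))) w
      + (ladderCoeff p h₂ (i + 1) (T - N) * ladderCoeff p h₁ (n - (i + 1)) N) •
        B (N - p * (n - (i + 1))) (S - (N - p * (n - (i + 1)))) w
      + (ladderCoeff p h₂ (i + 1) (T - N) *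
        ladderCoeff p h₂ (n - (i + 1)) (T - N - p * (i + 1))) • B N (S - N) w := by
    intro B hB hBw i N
    rw [hB.apply_apply hp ⟨e, he⟩ hBw (hpos i).1 (hpos i).2 (by simp only [T]; ring),
      show (i : ℤ) + 1 + (n - (i + 1)) = n by ring,
      show T - N = S - (N - p * n) by simp only [T]; ring,
      show S - (N - (p : ℤ) * n) - p * (n - (i + 1)) = S - (N - p * (i + 1)) by ring,
      show S - (N - (p : ℤ) * n) - p * (i + 1) = S - (N - p * (n - (i + 1))) by ring,
      show S - (N - (p : ℤ) * n) - p * n = S - N by ring]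
  have hmem : ∀ (i : Fin J) (N : ℤ), D N (T - N) (l (i + 1) (l (n - (i + 1)) w)) ∈ X := by
    intro i N
    rw [expand hD hDw]
    exact add_mem (add_mem (add_mem (X.smul_mem _ (hX _)) (X.smul_mem _ (hX _)))
      (X.smul_mem _ (hX _))) (X.smul_mem _ (hX _))
  obtain ⟨b, hb, hb0⟩ := exists_fin_relation (T := (Fin (p * k) → X) × (Fin 3 → ℂ)) fun i : Fin J =>
    (fun m => ⟨D m (T - m) (l (i + 1) (l (n - (i + 1)) w)), hmem i m⟩,
      fun q => ((i : ℂ) + 1) ^ (q : ℕ))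
  have hwin := congrArg Prod.fst hb
  have hpow := congrArg Prod.snd hb
  rw [Prod.fst_sum] at hwin
  rw [Prod.snd_sum] at hpow
  have hpow' : ∀ q : Fin 3, ∑ i, b i * ((i : ℂ) + 1) ^ (q : ℕ) = 0 := fun q => by
    have := congrFun hpow q
    simpa using this
  let w' : M := ∑ i : Fin J, b i • l (i + 1) (l (n - (i + 1)) w)
  have hDw' : ∀ N, D N (T - N) w' = 0 := by
    refine congrFun (eq_zero_of_window hp (hdiff T w' hT) fun L h0 h1 => ?_)
    have := congrArg Subtype.val (congrFun hwin ⟨L.toNat, by zify; omega⟩)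
    simp only [Finset.sum_apply, Prod.smul_fst, Pi.smul_apply, Prod.fst_zero, Pi.zero_apply,
      Int.toNat_of_nonneg h0, AddSubmonoidClass.coe_finsetSum, Submodule.coe_smul,
      ZeroMemClass.coe_zero] at this
    simpa only [w', map_sum, map_smul] using this
  obtain ⟨i₀, hi₀, hi₀min⟩ := wellFounded_lt.has_min {i | b i ≠ 0} hb0
  have hfin := hconcl T w' hT hDw' (N₀ + p * (i₀ + 1))
  set N₁ := N₀ + (p : ℤ) * (i₀ + 1) with hN₁
  have hterm : ∀ i : Fin J, b i • F N₁ (T - N₁) (l (i + 1) (l (n - (i + 1)) w)) =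
      (if i = i₀ then (b i * (ladderCoeff p h₁ (i + 1) N₁ *
        ladderCoeff p h₂ (n - (i + 1)) (T - N₁))) • F N₀ (S - N₀) w else 0)
      + (b i * (ladderCoeff p h₂ (i + 1) (T - N₁) *
        ladderCoeff p h₂ (n - (i + 1)) (T - N₁ - p * (i + 1)))) • F N₁ (S - N₁) w := by
    intro i
    have hi := i.2
    have hi' := i₀.2
    rw [expand hF hFw, hlt (N₁ - p * n), hlt (N₁ - p * (n - (i + 1)))]
    rotate_left
    · have : (p : ℤ) * (i₀ + 1) < p * (n - (i + 1)) :=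
        mul_lt_mul_of_pos_left (by simp only [n]; omega) hp'
      simp only [hN₁]; linarith
    · have : (p : ℤ) * (i₀ + 1) < p * n :=
        mul_lt_mul_of_pos_left (by simp only [n]; omega) hp'
      simp only [hN₁]; linarith
    rw [smul_zero, smul_zero, zero_add, add_zero, smul_add, smul_smul, smul_smul]
    congr 1
    split_ifs with h
    · rw [h, show N₁ - (p : ℤ) * (i₀ + 1) = N₀ by rw [hN₁]; ring]
    · rcases lt_or_gt_of_ne h with h' | h'
      · have : b i = 0 := by
          by_contra hbi
          exact hi₀min i hbi h'
        rw [this, zero_mul, zero_smul]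
      · rw [hlt, smul_zero]
        have : (p : ℤ) * (i₀ + 1) < p * (i + 1) :=
          mul_lt_mul_of_pos_left (by have : (i₀ : ℕ) < i := h'; omega) hp'
        simp only [hN₁]; linarith
  have hquad : ∑ i, b i * (ladderCoeff p h₂ (i + 1) (T - N₁) *
      ladderCoeff p h₂ (n - (i + 1)) (T - N₁ - p * (i + 1))) = 0 := by
    set H : ℂ := h₂ - 1
    set κ : ℂ := (T - N₁ : ℤ) / p with hκ
    have : ∀ i : Fin J, b i * (ladderCoeff p h₂ (i + 1) (T - N₁) *
        ladderCoeff p h₂ (n - (i + 1)) (T - N₁ - p * (i + 1))) =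
        ((H - κ) * ((1 - n) * H - κ)) * (b i * ((i : ℂ) + 1) ^ 0)
        + ((H - κ) * (H + 1) - H * ((1 - n) * H - κ)) * (b i * ((i : ℂ) + 1) ^ 1)
        + (-H * (H + 1)) * (b i * ((i : ℂ) + 1) ^ 2) := fun i => by
      have e1 : (((T - N₁ - p * (i + 1) : ℤ) : ℂ) / p) = κ - (i + 1) := by
        rw [hκ]; push_cast; field_simp
      rw [ladderCoeff, ladderCoeff, e1, ← hκ]
      push_cast
      ring
    simp only [this, Finset.sum_add_distrib, ← Finset.mul_sum]
    rw [show ∑ i, b i * ((i : ℂ) + 1) ^ 0 = 0 from hpow' 0,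
      show ∑ i, b i * ((i : ℂ) + 1) ^ 1 = 0 from hpow' 1,
      show ∑ i, b i * ((i : ℂ) + 1) ^ 2 = 0 from hpow' 2]
    ring
  simp only [w', map_sum, map_smul] at hfin
  rw [Finset.sum_congr rfl fun i _ => hterm i, Finset.sum_add_distrib, ← Finset.sum_smul, hquad,
    zero_smul, add_zero, Finset.sum_ite_eq' Finset.univ i₀, if_pos (Finset.mem_univ _)] at hfin
  refine smul_ne_zero (mul_ne_zero hi₀ (mul_ne_zero ?_ ?_)) hN₀ hfin
  · refine ladderCoeff_ne_zero hp fun hd => hN₀ (hdvd N₀ ?_)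
    rwa [hN₁, Int.dvd_add_left ⟨_, rfl⟩] at hd
  · refine ladderCoeff_ne_zero hp fun hd => hN₀ (hdvd' N₀ ?_)
    obtain ⟨c, hc⟩ := hd
    exact ⟨c - n + (i₀ + 1), by simp only [T, hN₁] at hc; linear_combination hc⟩

end Ladder

section Weights

variable {V : Type} [AddCommGroup V] [Module ℂ V] (𝒜 : VOA V)

/-- The vectors of weight `a`, as an eigenspace of `L(0)`. -/
def VOA.weightSpace (a : ℤ) : Submodule ℂ V := Module.End.eigenspace (𝒜.Y 𝒜.conf 1) (a : ℂ)

lemma VOA.mem_weightSpace {a : ℤ} {v : V} :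
    v ∈ 𝒜.weightSpace a ↔ 𝒜.Y 𝒜.conf 1 v = (a : ℂ) • v :=
  Module.End.mem_eigenspace_iff

lemma VOA.grade_le_weightSpace (a : ℤ) : 𝒜.grade a ≤ 𝒜.weightSpace a := fun v hv =>
  𝒜.mem_weightSpace.2 (𝒜.L0_grade a v hv)

lemma VOA.iSup_weightSpace : ⨆ a, 𝒜.weightSpace a = ⊤ :=
  top_le_iff.1 (𝒜.internal.submodule_iSup_eq_top.ge.trans (iSup_mono 𝒜.grade_le_weightSpace))

lemma VOA.exists_weightSpace_eq_bot : ∃ B : ℤ, ∀ a < B, 𝒜.weightSpace a = ⊥ := by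
  obtain ⟨B, hB⟩ := 𝒜.bddBelow
  refine ⟨B, fun a ha => ?_⟩
  have h := Module.End.eigenspaces_iSupIndep (𝒜.Y 𝒜.conf 1) (a : ℂ)
  have htop : ⨆ μ, ⨆ (_ : μ ≠ (a : ℂ)), Module.End.eigenspace (𝒜.Y 𝒜.conf 1) μ = ⊤ := by
    refine top_le_iff.1 (𝒜.internal.submodule_iSup_eq_top.ge.trans (iSup_le fun m => ?_))
    rcases lt_or_ge m B with hm | hm
    · rw [hB m hm]; exact bot_le
    · refine (𝒜.grade_le_weightSpace m).trans (le_iSup₂_of_le (m : ℂ) ?_ le_rfl)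
      exact_mod_cast (ha.trans_le hm).ne'
  rw [htop, disjoint_top] at h
  exact h

lemma VOA.conf_mode_mem_weightSpace {a : ℤ} {v : V} (hv : v ∈ 𝒜.weightSpace a) (i : ℤ) :
    𝒜.Y 𝒜.conf i v ∈ 𝒜.weightSpace (a + 1 - i) := by
  rw [𝒜.mem_weightSpace] at hv ⊢
  have h := LinearMap.congr_fun (𝒜.virasoro 0 (i - 1)) v
  simp only [LinearMap.sub_apply, LinearMap.add_apply, LinearMap.smul_apply, Module.End.mul_apply,
    Module.End.one_apply, zero_add, sub_add_cancel, hv, map_smul] at h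
  rw [sub_eq_iff_eq_add] at h
  rw [h]
  norm_num
  module

end Weights

lemma LadderComm.sub {M : Type} [AddCommGroup M] [Module ℂ M] {p : ℕ} {R h₁ h₂ : ℤ}
    {l : ℤ → Module.End ℂ M} {F G : ℤ → ℤ → Module.End ℂ M} (hF : LadderComm p R h₁ h₂ l F)
    (hG : LadderComm p R h₁ h₂ l G) : LadderComm p R h₁ h₂ l (F - G) := fun j N K w hd => by
  simp only [Pi.sub_apply, LinearMap.sub_apply, map_sub]
  rw [hF j N K w hd, hG j N K w hd]
  module

section JacobiAndVirasoro

variable {V M : Type} [AddCommGroup V] [Module ℂ V] [AddCommGroup M] [Module ℂ M]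
  {p : ℕ} {𝒜 : VOA V} {ν : V ≃ₗ[ℂ] V} {ω : ℂ} {YM : V →ₗ[ℂ] ℤ → Module.End ℂ M}
  {k k' : V → V → ℕ}

namespace AssocComm

variable (H : AssocComm p 𝒜 ν ω YM k k')
include H

lemma mode_conf_of_weight {b : ℤ} {v : V} (hv : v ∈ 𝒜.weightSpace b) :
    ∃ L : ℕ, ∀ (j N : ℤ) (w : M), YM v N (YM 𝒜.conf (p * (1 - j)) w) =
      YM 𝒜.conf (p * (1 - j)) (YM v N w) - ladderCoeff p b j N • YM v (N - p * j) w
      - ∑ i ∈ Finset.range L, cbinom (1 - j) (i + 2) •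
          YM (𝒜.Y 𝒜.conf (i + 2) v) (N - p * (j + 1 + i)) w := by
  obtain ⟨L, hL⟩ := 𝒜.trunc 𝒜.conf v
  have hpC := H.cast_ne_zero
  refine ⟨L.toNat, fun j N w => ?_⟩
  have h := H.conf_comm v w (1 - j) N
  rw [finsum_nat_eq_sum_range (K := L.toNat + 2), Finset.sum_range_succ',
    Finset.sum_range_succ'] at h
  · rw [← sub_sub_cancel (YM 𝒜.conf (p * (1 - j)) (YM v N w)) (YM v N (YM 𝒜.conf (p * (1 - j)) w)),
      h]
    have hlow : cbinom ((1 - j : ℤ) : ℂ) (0 + 1) •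
          YM (𝒜.Y 𝒜.conf ((0 + 1 : ℕ) : ℤ) v) (N + p * (1 - j) - p * ((0 + 1 : ℕ) : ℤ)) w
        + cbinom ((1 - j : ℤ) : ℂ) 0 •
          YM (𝒜.Y 𝒜.conf ((0 : ℕ) : ℤ) v) (N + p * (1 - j) - p * ((0 : ℕ) : ℤ)) w
        = ladderCoeff p b j N • YM v (N - p * j) w := by
      rw [zero_add, Nat.cast_one, Nat.cast_zero, 𝒜.mem_weightSpace.1 hv, cbinom_zero_right,
        cbinom_one_right, H.deriv_mode, one_smul, mul_one, mul_zero, sub_zero,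
        show N + (p : ℤ) * (1 - j) - p = N - p * j by ring, map_smul, Pi.smul_apply,
        LinearMap.smul_apply, LinearMap.smul_apply, smul_smul, ← add_smul, ladderCoeff]
      congr 1
      push_cast
      field_simp
      ring
    rw [add_assoc, hlow, add_comm, sub_add_eq_sub_sub]
    congr 1
    refine Finset.sum_congr rfl fun i _ => ?_
    rw [show N + (p : ℤ) * (1 - j) - p * ((i + 1 + 1 : ℕ) : ℤ) = N - p * (j + 1 + i) by
      push_cast; ring]
    push_cast
    rw [add_assoc, one_add_one_eq_two, show (i : ℤ) + 1 + 1 = i + 2 by ring]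
  · intro i hi
    rw [hL i (by omega), map_zero]
    simp

section BadLine

variable {R : ℤ} (hR : ∀ (x : V) (N : ℤ), (p : ℤ) ∣ N - R → YM x N = 0)
include hR

lemma prodSeq_eq_zero_of_eq_revSeq {u v : V} {w : M} {S : ℤ} (hS : (p : ℤ) ∣ S - R)
    (h : prodSeq YM u v w S = revSeq YM u v w S) : prodSeq YM u v w S = 0 := by
  have hJ : LineJacobi p 𝒜 ν ω YM u v w S := H.lineJacobi_of_zeroNearTop (by
    rw [h]; exact revSeq_zeroNearTop H.trunc _ _ _ _)
  have h0 : iterSeq p 𝒜 ν YM u v w S = 0 := by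
    ext s j
    obtain ⟨c, hc⟩ := hS
    rw [iterSeq, hR _ _ ⟨c - j, by linear_combination hc⟩]
    rfl
  rw [LineJacobi, h0] at hJ
  exact hJ.eq_zero_of_iter_eq_zero H.pos (prodSeq_zeroNearBot H.trunc _ _ _ _)
    (revSeq_zeroNearTop H.trunc _ _ _ _)

omit hR in
lemma rev_eq_zero_of_prod_eq_zero {u v : V} (h : ∀ (w : M) (N K : ℤ), (p : ℤ) ∣ N + K - R →
    YM u N (YM v K w) = 0) (w : M) (N K : ℤ) (hd : (p : ℤ) ∣ N + K - R) :
    YM v K (YM u N w) = 0 := by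
  have h0 : prodSeq YM u v w (N + K) = 0 := by
    ext L
    exact h w _ _ (by rwa [add_sub_cancel])
  have := congrFun (H.prodSeq_eq_revSeq (u := u) (v := v) (w := w) (S := N + K)
    ⟨0, fun _ _ => by rw [h0]; rfl⟩) N
  rw [h0, revSeq, add_sub_cancel_left] at this
  exact this.symm

omit hR in
lemma exists_prodSeq_eq_zero (u v : V) (w : M) : ∃ B : ℤ, ∀ S ≥ B, prodSeq YM u v w S = 0 := by
  obtain ⟨B, hB⟩ := H.trunc u w
  obtain ⟨C, hC⟩ := H.trunc v w
  refine ⟨B + C + p * k u v, fun S hS => ?_⟩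
  refine eq_zero_of_binP_eq_zero_of_bot (k := k u v) H.pos (prodSeq_zeroNearBot H.trunc _ _ _ _) ?_
  ext a
  rcases le_or_gt B a with ha | ha
  · rw [twWC_iff.1 (H.wc u v) w S, binP_natCast, Pi.zero_apply]
    refine Finset.sum_eq_zero fun i hi => ?_
    have : (0 : ℤ) ≤ p * ((k u v : ℤ) - i) :=
      mul_nonneg H.pos_int.le (by simp only [Finset.mem_range] at hi; omega)
    rw [revSeq, hB _ (by omega), map_zero, smul_zero]
  · rw [binP_natCast, Pi.zero_apply]
    refine Finset.sum_eq_zero fun i hi => ?_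
    have : (0 : ℤ) ≤ p * i := by positivity
    rw [prodSeq, hC _ (by linarith), map_zero, smul_zero]

lemma prod_eq_zero_step {a b : ℤ} {u v : V} (hu : u ∈ 𝒜.weightSpace a)
    (hv : v ∈ 𝒜.weightSpace b)
    (ihu : ∀ i : ℕ, ∀ (w : M) (N K : ℤ), (p : ℤ) ∣ N + K - R →
      YM (𝒜.Y 𝒜.conf (i + 2) u) N (YM v K w) = 0)
    (ihv : ∀ i : ℕ, ∀ (w : M) (N K : ℤ), (p : ℤ) ∣ N + K - R →
      YM u N (YM (𝒜.Y 𝒜.conf (i + 2) v) K w) = 0)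
    (w : M) (N K : ℤ) (hd : (p : ℤ) ∣ N + K - R) : YM u N (YM v K w) = 0 := by
  by_contra hne
  obtain ⟨B, hB⟩ := H.exists_prodSeq_eq_zero u v w
  obtain ⟨S, ⟨hSR, hSne⟩, hSmax⟩ := Int.exists_greatest_of_bdd
    (P := fun S => (p : ℤ) ∣ S - R ∧ prodSeq YM u v w S ≠ 0)
    ⟨B, fun z hz => by by_contra h; exact hz.2 (hB z (by omega))⟩
    ⟨N + K, hd, fun h => hne (by have := congrFun h N; rwa [prodSeq, add_sub_cancel_left] at this)⟩
  obtain ⟨Lu, hLu⟩ := H.mode_conf_of_weight hu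
  obtain ⟨Lv, hLv⟩ := H.mode_conf_of_weight hv
  have shift : ∀ {N K : ℤ} (c : ℤ), (p : ℤ) ∣ N + K - R → (p : ℤ) ∣ N + K - p * c - R :=
    fun {N K} c ⟨d, hd⟩ => ⟨d - c, by linear_combination hd⟩
  have hF : LadderComm p R a b (fun j => YM 𝒜.conf (p * (1 - j)))
      (fun N K => YM u N * YM v K) := fun j N K w hd => by
    simp only [Module.End.mul_apply]
    rw [hLv j K w, map_sub, map_sub, hLu j N, map_smul, map_sum, Finset.sum_eq_zero,
      Finset.sum_eq_zero, sub_zero, sub_zero]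
    · intro i _
      rw [map_smul, ihv, smul_zero]
      convert shift (j + 1 + i) hd using 1; ring
    · intro i _
      rw [ihu, smul_zero]
      convert shift (j + 1 + i) hd using 1; ring
  have hG : LadderComm p R a b (fun j => YM 𝒜.conf (p * (1 - j)))
      (fun N K => YM v K * YM u N) := fun j N K w hd => by
    simp only [Module.End.mul_apply]
    rw [hLu j N w, map_sub, map_sub, hLv j K, map_smul, map_sum, Finset.sum_eq_zero,
      Finset.sum_eq_zero, sub_zero, sub_zero, sub_right_comm]
    · intro i _
      rw [map_smul, H.rev_eq_zero_of_prod_eq_zero (ihu i), smul_zero]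
      convert shift (j + 1 + i) hd using 1; ring
    · intro i _
      rw [H.rev_eq_zero_of_prod_eq_zero (ihv i), smul_zero]
      convert shift (j + 1 + i) hd using 1; ring
  have hzero : ∀ N K : ℤ, (p : ℤ) ∣ N + K - R → S < N + K → prodSeq YM u v w (N + K) = 0 :=
    fun N K hd hlt => by
      by_contra h
      have := hSmax _ ⟨hd, h⟩
      omega
  have hFw : ∀ N K : ℤ, (p : ℤ) ∣ N + K - R → S < N + K → YM u N (YM v K w) = 0 :=
    fun N K hd hlt => by
      have := congrFun (hzero N K hd hlt) N
      rwa [prodSeq, add_sub_cancel_left] at this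
  have hGw : ∀ N K : ℤ, (p : ℤ) ∣ N + K - R → S < N + K → YM v K (YM u N w) = 0 :=
    fun N K hd hlt => by
      have := congrFun (H.prodSeq_eq_revSeq (u := u) (v := v) (w := w) (S := N + K)
        ⟨0, fun _ _ => by rw [hzero N K hd hlt]; rfl⟩) N
      rw [hzero N K hd hlt, revSeq, add_sub_cancel_left] at this
      exact this.symm
  refine hSne (funext fun N => eq_zero_of_ladderComm H.pos (k := k u v) hF (hF.sub hG) hSR
    hFw (fun N K hd hlt => ?_) (fun T w' hT => ?_) (fun T w' hT h => ?_)
    (prodSeq_zeroNearBot H.trunc u v w S) (fun N hN => ?_) (fun N hN => ?_) N)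
  · simp only [Pi.sub_apply, LinearMap.sub_apply, Module.End.mul_apply, hFw N K hd hlt,
      hGw N K hd hlt, sub_zero]
  · change binP p (k u v) (prodSeq YM u v w' T - revSeq YM u v w' T) = 0
    rw [binP_natCast_sub, twWC_iff.1 (H.wc u v) w' T, sub_self]
  · refine congrFun (H.prodSeq_eq_zero_of_eq_revSeq hR hT (u := u) (v := v) (w := w') ?_)
    ext N
    exact sub_eq_zero.1 (h N)
  · obtain ⟨c, hc⟩ := hSR
    obtain ⟨d, hd⟩ := hN
    rw [Module.End.mul_apply, hR v (S - N) ⟨c - d, by linear_combination hc - hd⟩,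
      LinearMap.zero_apply, map_zero]
  · obtain ⟨c, hc⟩ := hSR
    obtain ⟨d, hd⟩ := hN
    rw [Module.End.mul_apply, hR u N ⟨c - d, by linear_combination hc - hd⟩, LinearMap.zero_apply]

lemma prod_eq_zero (u v : V) (w : M) (N K : ℤ) (hd : (p : ℤ) ∣ N + K - R) :
    YM u N (YM v K w) = 0 := by
  obtain ⟨B, hB⟩ := 𝒜.exists_weightSpace_eq_bot
  have hom : ∀ (n : ℕ) (a b : ℤ), a + b < 2 * B + n → ∀ u ∈ 𝒜.weightSpace a,
      ∀ v ∈ 𝒜.weightSpace b, ∀ (w : M) (N K : ℤ), (p : ℤ) ∣ N + K - R →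
      YM u N (YM v K w) = 0 := by
    intro n
    induction n with
    | zero =>
      intro a b hab u hu v hv w N K _
      rcases lt_or_ge a B with ha | ha
      · rw [hB a ha, Submodule.mem_bot] at hu
        simp [hu]
      · rw [hB b (by push_cast at hab; omega), Submodule.mem_bot] at hv
        simp [hv]
    | succ n ih =>
      intro a b hab u hu v hv
      refine H.prod_eq_zero_step hR hu hv (fun i => ?_) fun i => ?_
      · exact ih _ _ (by push_cast at hab ⊢; omega) _ (𝒜.conf_mode_mem_weightSpace hu _) v hv
      · exact ih _ _ (by push_cast at hab ⊢; omega) u hu _ (𝒜.conf_mode_mem_weightSpace hv _)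
  have hu : u ∈ ⨆ a, 𝒜.weightSpace a := by rw [𝒜.iSup_weightSpace]; trivial
  have hv : v ∈ ⨆ a, 𝒜.weightSpace a := by rw [𝒜.iSup_weightSpace]; trivial
  induction hu using Submodule.iSup_induction' with
  | zero => simp
  | add x y _ _ hx hy => simp [hx, hy]
  | mem a u hu =>
    induction hv using Submodule.iSup_induction' with
    | zero => simp
    | add x y _ _ hx hy => simp [hx, hy]
    | mem b v hv => exact hom (a + b - 2 * B + 1).toNat a b (by omega) u hu v hv w N K hd

end BadLine

lemma lineJacobi (u v : V) (w : M) (S : ℤ) : LineJacobi p 𝒜 ν ω YM u v w S := by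
  by_cases h : ∀ u v w, LineJacobi p 𝒜 ν ω YM u v w S
  · exact h u v w
  · refine H.lineJacobi_of_zeroNearTop ⟨0, fun N _ => ?_⟩
    exact H.prod_eq_zero (fun x N hN => H.mode_eq_zero_of_modEq h hN x) u v w _ _
      ⟨0, by ring⟩

lemma twJacobi : TwJacobi p 𝒜 ν ω YM :=
  twJacobi_iff.2 H.lineJacobi

lemma virasoro (hvac : ∀ n : ℤ, YM 𝒜.vac n = if n = -(p : ℤ) then 1 else 0) (m n : ℤ) :
    YM 𝒜.conf ((p : ℤ) * (m + 1)) * YM 𝒜.conf ((p : ℤ) * (n + 1))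
        - YM 𝒜.conf ((p : ℤ) * (n + 1)) * YM 𝒜.conf ((p : ℤ) * (m + 1))
      = ((m - n : ℤ) : ℂ) • YM 𝒜.conf ((p : ℤ) * (m + n + 1))
        + (if m + n = 0 then ((m ^ 3 - m : ℤ) : ℂ) / 12 * 𝒜.cc else 0) •
            (1 : Module.End ℂ M) := by
  have hpC := H.cast_ne_zero
  have hp := H.pos_int
  ext w
  have := H.conf_comm_conf_of_lineJacobi (w := w) (n := m + 1) (N := p * (n + 1))
    (H.lineJacobi _ _ _ _)
  simp only [LinearMap.sub_apply, LinearMap.add_apply, LinearMap.smul_apply, Module.End.mul_apply]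
  rw [this, hvac, show (p : ℤ) * (n + 1) + p * (m + 1) - p = p * (m + n + 1) by ring]
  congr 1
  · congr 1
    push_cast
    field_simp
    ring
  · have hiff : (p : ℤ) * (n + 1) + p * (m + 1) - 3 * p = -p ↔ m + n = 0 := by
      constructor
      · intro h
        refine (mul_eq_zero.1 (?_ : (p : ℤ) * (m + n) = 0)).resolve_left hp.ne'
        linear_combination h
      · intro h
        linear_combination (p : ℤ) * h
    simp only [hiff]
    split_ifs
    · rw [Module.End.one_apply, cbinom_three]
      congr 1
      push_cast
      ring
    · simp

end AssocComm

end JacobiAndVirasoro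

section S8

variable {V M : Type} [AddCommGroup V] [Module ℂ V] [AddCommGroup M] [Module ℂ M]

/-- Theorem 5.1, equivalence theorem.  (i) If modified weak
associativity holds with exponents `k'(u,v)` and weak commutativity holds with exponents
`k(u,v)`, then modified weak associativity also holds with the exponents `k(u,v)`, and
the twisted Jacobi identity holds; and if in addition `M` carries a `ℚ`-grading with the
quasi-finiteness, lower-boundedness, `L_M(0)`-weight and vacuum properties, then `M` is a
`ν`-twisted `V`-module.  (ii) Conversely, the twisted Jacobi identity implies modified
weak associativity and weak commutativity (for suitable exponents). -/
theorem statement8 (p : ℕ) (hp : 0 < p) (𝒜 : VOA V) (ν : V ≃ₗ[ℂ] V)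
    (hν_vac : ν 𝒜.vac = 𝒜.vac) (hν_conf : ν 𝒜.conf = 𝒜.conf)
    (hν_Y : ∀ (u : V) (n : ℤ) (v : V), ν (𝒜.Y u n v) = 𝒜.Y (ν u) n (ν v))
    (hν_per : ν ^ p = 1) (ωp : ℂ) (hωp : IsPrimitiveRoot ωp p)
    (YM : V →ₗ[ℂ] ℤ → Module.End ℂ M)
    (hT : TwTrunc YM) :
    ((∀ k k' : V → V → ℕ,
        (∀ u v : V, TwMWA p 𝒜 ν ωp YM (k' u v) u v) →
        (∀ u v : V, TwWC p YM (k u v) u v) →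
        ((∀ u v : V, TwMWA p 𝒜 ν ωp YM (k u v) u v) ∧
         TwJacobi p 𝒜 ν ωp YM ∧
         (∀ grade : ℚ → Submodule ℂ M,
            DirectSum.IsInternal grade →
            (∀ q : ℚ, FiniteDimensional ℂ (grade q)) →
            (∃ N : ℚ, ∀ q < N, grade q = ⊥) →
            (∀ q : ℚ, ∀ w ∈ grade q, YM 𝒜.conf (p : ℤ) w = (q : ℂ) • w) →
            (∀ n : ℤ, YM 𝒜.vac n = if n = -(p : ℤ) then 1 else 0) →
            IsTwistedModule p 𝒜 ν ωp YM grade))))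
    ∧ (TwJacobi p 𝒜 ν ωp YM →
        ∀ u v : V, (∃ k : ℕ, TwMWA p 𝒜 ν ωp YM k u v) ∧ (∃ k : ℕ, TwWC p YM k u v)) := by
  refine ⟨fun k k' hmwa hwc => ?_, fun hJ u v => ?_⟩
  · have H : AssocComm p 𝒜 ν ωp YM k k' :=
      ⟨hp, hωp, hν_per, hν_vac, hν_conf, hT, hwc, hmwa⟩
    refine ⟨fun u v => twMWA_of_twJacobi_of_twWC hp hωp hν_per hT H.twJacobi (hwc u v),
      H.twJacobi, fun grade hint hfin hbdd hL0 hvac => ?_⟩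
    exact ⟨hint, hfin, hbdd, hT, hvac, H.virasoro hvac, hL0, H.deriv_mode, H.twJacobi⟩
  · obtain ⟨k, hk⟩ := exists_twWC_of_twJacobi hp hν_per hJ u v
    exact ⟨⟨k, twMWA_of_twJacobi_of_twWC hp hωp hν_per hT hJ hk⟩, k, hk⟩

end S8
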